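/- Main Theorem (shape-free formulation). Let n ≥ 1, let M be a topological n-manifold, and let f : [0,1] × M → M be a continuous family of homeomorphisms of M. Suppose that (1) K ⊆ M is a compact attractor of f₀; (2) K is a topological spine of some compact n-manifold with boundary N ⊆ M that has the concentric rigidity property; and (3) K undergoes a Hopf bifurcation at λ = 0 (K is a repeller of f_λ for every λ ∈ (0,1]). Then there exists λ₀ > 0 such that for every λ with 0 < λ < λ₀ there exists a compact attractor K_λ of f_λ which is a topological spine of a compact subset of M homeomorphic to ∂N × [0,1] (in particular K_λ has the Borsuk homotopy type of ∂N), and the family K_λ converges to K upper semicontinuously as λ → 0. -/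

import Mathlib

open Set Topology unitInterval

/-- `A` is homeomorphic to an open subset of `B`. -/
def HomeoToOpen (A : Type*) [TopologicalSpace A] (B : Type*) [TopologicalSpace B] : Prop :=
  ∃ U : Set B, IsOpen U ∧ Nonempty (A ≃ₜ U)

/-- The half-space `ℝ^{n-1} × [0,∞)`. -/
abbrev HalfSpace (n : ℕ) : Type :=
  EuclideanSpace ℝ (Fin (n - 1)) × {t : ℝ // 0 ≤ t}

/-- Every point has an open neighborhood homeomorphic to an open subset of `ℝⁿ`. -/
def LocallyEuclidean (n : ℕ) (M : Type*) [TopologicalSpace M] : Prop :=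
  ∀ x : M, ∃ V : Set M, IsOpen V ∧ x ∈ V ∧ HomeoToOpen V (EuclideanSpace ℝ (Fin n))

/-- Every point has an open neighborhood homeomorphic to an open subset of the
half-space `ℝ^{n-1} × [0,∞)`. -/
def LocallyHalfSpace (n : ℕ) (M : Type*) [TopologicalSpace M] : Prop :=
  ∀ x : M, ∃ V : Set M, IsOpen V ∧ x ∈ V ∧ HomeoToOpen V (HalfSpace n)

/-- The manifold boundary of a space: points with no open neighborhood homeomorphic to
an open subset of `ℝⁿ`. -/
def spaceBoundary (n : ℕ) (M : Type*) [TopologicalSpace M] : Set M :=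
  {x | ¬ ∃ V : Set M, IsOpen V ∧ x ∈ V ∧ HomeoToOpen V (EuclideanSpace ℝ (Fin n))}

variable {X : Type*} [TopologicalSpace X]

/-- A subset which is a compact `n`-manifold with boundary (subspace topology). -/
def IsCompactMfldBdry (n : ℕ) (N : Set X) : Prop :=
  IsCompact N ∧ LocallyHalfSpace n ↥N

/-- The boundary of a subset which is a manifold with boundary, as a subset of the
ambient space. -/
def subsetBoundary (n : ℕ) (N : Set X) : Set X :=
  Subtype.val '' spaceBoundary n ↥N

/-- `S` is bicollared in the ambient space. -/
def Bicollared (S : Set X) : Prop :=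
  ∃ b : ↥S × ↥(Set.Icc (-1 : ℝ) 1) → X,
    Topology.IsEmbedding b ∧ ∀ x : ↥S, b (x, ⟨0, by norm_num⟩) = (x : X)

/-- `M` and `N` (compact `n`-manifolds with boundary, `N ⊆ int M`) are concentric:
`M \ int N` is homeomorphic to `∂M × [0,1]`. -/
def Concentric (n : ℕ) (M N : Set X) : Prop :=
  Nonempty (↥(M \ interior N) ≃ₜ ↥(subsetBoundary n M) × ↥(Set.Icc (0 : ℝ) 1))

/-- `K` is a topological spine of the compact `n`-manifold with boundary `N`:
`K ⊆ int N` and `N \ K` is homeomorphic to `∂N × [0,∞)`. -/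
def IsSpine (n : ℕ) (N K : Set X) : Prop :=
  K ⊆ interior N ∧
    Nonempty (↥(N \ K) ≃ₜ ↥(subsetBoundary n N) × ↥(Set.Ici (0 : ℝ)))

/-- The ω-limit set of `Y` under a map `f`. -/
def omegaSet (f : X → X) (Y : Set X) : Set X :=
  ⋂ (n : ℕ) (_ : 1 ≤ n), closure (⋃ (k : ℕ) (_ : n ≤ k), f^[k] '' Y)

/-- `K` is an attractor of the homeomorphism `f`. -/
def IsAttractor (f : X ≃ₜ X) (K : Set X) : Prop :=
  IsCompact K ∧ ∃ U : Set X, U ∈ 𝓝ˢ K ∧ K = omegaSet f U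

/-- `K` is a repeller of the homeomorphism `f`. -/
def IsRepeller (f : X ≃ₜ X) (K : Set X) : Prop :=
  IsAttractor f.symm K

/-- A continuous family of homeomorphisms parametrized by the unit interval. -/
def ContinuousFamily {M : Type*} [TopologicalSpace M] (f : unitInterval → M ≃ₜ M) : Prop :=
  Continuous (fun p : unitInterval × M => f p.1 p.2) ∧
    Continuous (fun p : unitInterval × M => (f p.1).symm p.2)

/-- `M` has the concentric rigidity property (as a subset of the ambient space). -/
def ConcentricRigidity (n : ℕ) (M : Set X) : Prop :=
  ∀ M₀ M₁ : Set X, IsCompactMfldBdry n M₀ → IsCompactMfldBdry n M₁ →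
    M₀ ⊆ interior M₁ → M₁ ⊆ interior M →
    Bicollared (subsetBoundary n M₁) →
    Nonempty (↥(subsetBoundary n M₁) ≃ₜ ↥(subsetBoundary n M)) →
    Concentric n M M₀ →
    Concentric n M₁ M₀ ∧ Concentric n M M₁

section LS
variable {A B C D : Type*} [TopologicalSpace A] [TopologicalSpace B] [TopologicalSpace C]
  [TopologicalSpace D]

def LocSame (a : A) (b : B) : Prop := ∃ e : OpenPartialHomeomorph A B, a ∈ e.source ∧ e a = b

def EucAt (n : ℕ) (x : A) : Prop :=
  ∃ V : Set A, IsOpen V ∧ x ∈ V ∧ HomeoToOpen V (EuclideanSpace ℝ (Fin n))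

def HalfAt (n : ℕ) (x : A) : Prop :=
  ∃ V : Set A, IsOpen V ∧ x ∈ V ∧ HomeoToOpen V (HalfSpace n)

lemma LocSame.refl (a : A) : LocSame a a := ⟨OpenPartialHomeomorph.refl A, by simp, by simp⟩

lemma LocSame.symm {a : A} {b : B} (h : LocSame a b) : LocSame b a := by
  obtain ⟨e, h1, rfl⟩ := h
  exact ⟨e.symm, by simpa using e.map_source h1, by simp [h1]⟩

lemma LocSame.trans {a : A} {b : B} {c : C} (h : LocSame a b) (h' : LocSame b c) :
    LocSame a c := by
  obtain ⟨e, h1, rfl⟩ := h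
  obtain ⟨e', h1', rfl⟩ := h'
  exact ⟨e.trans e', by simp [h1, h1'], by simp⟩

lemma LocSame.prod {a : A} {b : B} {c : C} {d : D} (h : LocSame a b) (h' : LocSame c d) :
    LocSame (a, c) (b, d) := by
  obtain ⟨e, h1, rfl⟩ := h
  obtain ⟨e', h1', rfl⟩ := h'
  exact ⟨e.prod e', by simp [h1, h1'], by simp⟩

lemma Homeomorph.locSame (e : A ≃ₜ B) (a : A) : LocSame a (e a) :=
  ⟨e.toOpenPartialHomeomorph, by simp, by simp⟩

lemma locSame_coe {V : Set A} (hV : IsOpen V) (x : V) : LocSame x (x : A) :=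
  ⟨TopologicalSpace.Opens.openPartialHomeomorphSubtypeCoe ⟨V, hV⟩ ⟨x⟩, by simp, rfl⟩

lemma homeoAt_iff {x : A} : (∃ V : Set A, IsOpen V ∧ x ∈ V ∧ HomeoToOpen V B) ↔
    ∃ y : B, LocSame x y := by
  constructor
  · rintro ⟨V, hV, hx, U, hU, ⟨φ⟩⟩
    exact ⟨_, ((locSame_coe hV ⟨x, hx⟩).symm.trans (φ.locSame _)).trans (locSame_coe hU _)⟩
  · rintro ⟨y, e, he, rfl⟩
    exact ⟨e.source, e.open_source, he, e.target, e.open_target, ⟨e.toHomeomorphSourceTarget⟩⟩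

lemma eucAt_iff {n : ℕ} {x : A} : EucAt n x ↔ ∃ y : EuclideanSpace ℝ (Fin n), LocSame x y :=
  homeoAt_iff

lemma halfAt_iff {n : ℕ} {x : A} : HalfAt n x ↔ ∃ y : HalfSpace n, LocSame x y :=
  homeoAt_iff

lemma LocSame.eucAt {n : ℕ} {a : A} {b : B} (h : LocSame a b) : EucAt n a ↔ EucAt n b := by
  rw [eucAt_iff, eucAt_iff]
  exact ⟨fun ⟨y, hy⟩ => ⟨y, h.symm.trans hy⟩, fun ⟨y, hy⟩ => ⟨y, h.trans hy⟩⟩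

lemma LocSame.halfAt {n : ℕ} {a : A} {b : B} (h : LocSame a b) : HalfAt n a ↔ HalfAt n b := by
  rw [halfAt_iff, halfAt_iff]
  exact ⟨fun ⟨y, hy⟩ => ⟨y, h.symm.trans hy⟩, fun ⟨y, hy⟩ => ⟨y, h.trans hy⟩⟩

open Classical in
lemma locSame_sub (e : OpenPartialHomeomorph A B) {S : Set A} {S' : Set B}
    (hS : ∀ x ∈ e.source, x ∈ S ↔ e x ∈ S') {a : A} (ha : a ∈ e.source) (haS : a ∈ S)
    (hb : e a ∈ S') : LocSame (⟨a, haS⟩ : S) (⟨e a, hb⟩ : S') := by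
  have hS2 : ∀ y ∈ e.target, y ∈ S' ↔ e.symm y ∈ S := by
    intro y hy
    rw [hS _ (e.map_target hy), e.right_inv hy]
  let F : S → S' := fun x => if h : e x ∈ S' then ⟨e x, h⟩ else ⟨e a, hb⟩
  let G : S' → S := fun y => if h : e.symm y ∈ S then ⟨e.symm y, h⟩ else ⟨a, haS⟩
  have hF : ∀ x : S, (x : A) ∈ e.source → (F x : B) = e x := by
    intro x hx
    have : e x ∈ S' := (hS _ hx).1 x.2
    simp [F, this]
  have hG : ∀ y : S', (y : B) ∈ e.target → (G y : A) = e.symm y := by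
    intro y hy
    have : e.symm y ∈ S := (hS2 _ hy).1 y.2
    simp [G, this]
  refine ⟨{ toFun := F, invFun := G, source := Subtype.val ⁻¹' e.source,
            target := Subtype.val ⁻¹' e.target
            map_source' := ?_, map_target' := ?_, left_inv' := ?_, right_inv' := ?_
            continuousOn_toFun := ?_, continuousOn_invFun := ?_
            open_source := e.open_source.preimage continuous_subtype_val
            open_target := e.open_target.preimage continuous_subtype_val }, ha, ?_⟩
  · intro x hx
    change (F x : B) ∈ e.target
    rw [hF x hx]; exact e.map_source hx
  · intro x hx
    change (G x : A) ∈ e.source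
    rw [hG x hx]; exact e.map_target hx
  · intro x hx
    apply Subtype.ext
    change (G (F x) : A) = x
    rw [hG _ (by rw [hF x hx]; exact e.map_source hx), hF x hx, e.left_inv hx]
  · intro x hx
    apply Subtype.ext
    change (F (G x) : B) = x
    rw [hF _ (by rw [hG x hx]; exact e.map_target hx), hG x hx, e.right_inv hx]
  · rw [IsInducing.subtypeVal.continuousOn_iff]
    exact (e.continuousOn.comp continuous_subtype_val.continuousOn (fun x hx => hx)).congr
      (fun x hx => hF x hx)
  · rw [IsInducing.subtypeVal.continuousOn_iff]
    exact (e.symm.continuousOn.comp continuous_subtype_val.continuousOn (fun x hx => hx)).congr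
      (fun x hx => hG x hx)
  · exact Subtype.ext (hF _ ha)

lemma locSame_of_inter {S S' : Set A} {O : Set A} (hO : IsOpen O) {x : A} (hx : x ∈ O)
    (h : ∀ y ∈ O, y ∈ S ↔ y ∈ S') (hS : x ∈ S) (hS' : x ∈ S') :
    LocSame (⟨x, hS⟩ : S) (⟨x, hS'⟩ : S') :=
  locSame_sub (OpenPartialHomeomorph.ofSet O hO) (by simpa using h) (by simpa using hx) hS hS'

lemma locSame_of_nhds {S : Set A} {O : Set A} (hO : IsOpen O) {x : A} (hx : x ∈ O)
    (h : O ⊆ S) (hS : x ∈ S) : LocSame (⟨x, hS⟩ : S) x := by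
  refine (locSame_of_inter (S' := univ) hO hx ?_ hS (mem_univ x)).trans (locSame_coe isOpen_univ _)
  intro y hy; simp [h hy]

lemma locSame_image (F : A ≃ₜ B) {S : Set A} {x : A} (hx : x ∈ S) (h' : F x ∈ F '' S) :
    LocSame (⟨x, hx⟩ : S) (⟨F x, h'⟩ : F '' S) :=
  locSame_sub F.toOpenPartialHomeomorph (S' := F '' S) (by intro y _; simp) (by simp) hx h'

end LS

section model
variable {n : ℕ}

/-- No point of the boundary of the half-space is Euclidean. -/
def PP (n : ℕ) : Prop := ∀ y : EuclideanSpace ℝ (Fin (n - 1)),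
  ¬ EucAt n ((y, ⟨0, le_refl _⟩) : HalfSpace n)

lemma euc_split (hn : 1 ≤ n) : Nonempty (EuclideanSpace ℝ (Fin (n - 1)) × ℝ ≃ₜ
    EuclideanSpace ℝ (Fin n)) := by
  refine ⟨(ContinuousLinearEquiv.ofFinrankEq (𝕜 := ℝ) ?_).toHomeomorph⟩
  simp; omega

lemma eucAt_prod (hn : 1 ≤ n) (p : EuclideanSpace ℝ (Fin (n - 1)) × ℝ) : EucAt n p := by
  obtain ⟨φ⟩ := euc_split hn
  exact eucAt_iff.2 ⟨_, φ.locSame p⟩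

lemma locSame_Ici {a t : ℝ} (h : a < t) (ht : a ≤ t) : LocSame (⟨t, ht⟩ : {s : ℝ // a ≤ s}) t :=
  locSame_of_nhds (S := Ici a) isOpen_Ioi h (fun _ hx => (mem_Ioi.1 hx).le) ht

lemma eucAt_half (hn : 1 ≤ n) (y : EuclideanSpace ℝ (Fin (n - 1))) (t : {t : ℝ // 0 ≤ t})
    (h : 0 < (t : ℝ)) : EucAt n ((y, t) : HalfSpace n) :=
  (((LocSame.refl y).prod (locSame_Ici h t.2)).eucAt).2 (eucAt_prod hn _)

lemma eucAt_half_all (hn : 1 ≤ n) (hP : ¬ PP n) (z : HalfSpace n) : EucAt n z := by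
  obtain ⟨y, t⟩ := z
  rcases eq_or_lt_of_le t.2 with h | h
  · unfold PP at hP
    push Not at hP
    obtain ⟨y', hy'⟩ := hP
    have : LocSame y y' := by
      have := (Homeomorph.addRight (y' - y)).locSame y
      simpa using this
    obtain rfl : t = ⟨0, le_refl _⟩ := Subtype.ext h.symm
    exact ((this.prod (LocSame.refl _)).eucAt).2 hy'
  · exact eucAt_half hn y t h

lemma eucAt.halfAt {A : Type*} [TopologicalSpace A] (hn : 1 ≤ n) {x : A} (h : EucAt n x) :
    HalfAt n x := by
  obtain ⟨y, hy⟩ := eucAt_iff.1 h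
  obtain ⟨φ⟩ := euc_split hn
  have h1 := hy.trans (φ.symm.locSame y)
  have h2 : LocSame (φ.symm y).2 (Real.exp (φ.symm y).2) := by
    refine ⟨Real.expPartialHomeomorph, by simp, by simp⟩
  have h3 := (locSame_Ici (Real.exp_pos (φ.symm y).2) (Real.exp_pos _).le).symm
  exact halfAt_iff.2 ⟨_, h1.trans ((LocSame.refl _).prod (h2.trans h3))⟩

/-- local structure of the boundary -/
def LocEuc1 (n : ℕ) (E : Type*) [TopologicalSpace E] : Prop :=
  ∀ e : E, ∃ y : EuclideanSpace ℝ (Fin (n - 1)), LocSame e y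

lemma locEuc1_boundary {N : Type*} [TopologicalSpace N] (hn : 1 ≤ n) (hP : PP n)
    (hN : LocallyHalfSpace n N) : LocEuc1 n (spaceBoundary n N) := by
  rintro ⟨x, hx⟩
  obtain ⟨⟨y, t⟩, e, he, hy⟩ := halfAt_iff.1 (hN x)
  have key : ∀ z ∈ e.source, z ∈ spaceBoundary n N ↔ ((e z).2 : ℝ) = 0 := by
    intro z hz
    have hls : LocSame z (e z) := ⟨e, hz, rfl⟩
    change ¬ EucAt n z ↔ _
    rw [hls.eucAt]
    constructor
    · intro h
      by_contra h0
      exact h (eucAt_half hn _ _ (lt_of_le_of_ne (e z).2.2 (Ne.symm h0)))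
    · intro h0
      have : e z = ((e z).1, ⟨0, le_refl _⟩) := Prod.ext rfl (Subtype.ext h0)
      rw [this]; exact hP _
  have h1 := locSame_sub e (S := spaceBoundary n N) (S' := {z : HalfSpace n | (z.2 : ℝ) = 0})
    key he hx ((key x he).1 hx)
  let φ : {z : HalfSpace n | (z.2 : ℝ) = 0} ≃ₜ EuclideanSpace ℝ (Fin (n - 1)) :=
    { toFun := fun z => z.1.1
      invFun := fun y => ⟨(y, ⟨0, le_refl _⟩), rfl⟩
      left_inv := fun z => Subtype.ext (Prod.ext rfl (Subtype.ext z.2.symm))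
      right_inv := fun y => rfl
      continuous_toFun := by fun_prop
      continuous_invFun := by fun_prop }
  exact ⟨_, h1.trans (φ.locSame _)⟩

variable {E : Type*} [TopologicalSpace E]

lemma not_eucAt_zero (hP : PP n) (hE : LocEuc1 n E) (e : E) :
    ¬ EucAt n ((e, ⟨0, le_refl _⟩) : E × {t : ℝ // 0 ≤ t}) := by
  obtain ⟨y, hy⟩ := hE e
  rw [(hy.prod (LocSame.refl _)).eucAt]
  exact hP y

lemma halfAt_zero (hE : LocEuc1 n E) (e : E) :
    HalfAt n ((e, ⟨0, le_refl _⟩) : E × {t : ℝ // 0 ≤ t}) := by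
  obtain ⟨y, hy⟩ := hE e
  exact halfAt_iff.2 ⟨_, hy.prod (LocSame.refl _)⟩

lemma eucAt_E (hn : 1 ≤ n) (hE : LocEuc1 n E) (p : E × ℝ) : EucAt n p := by
  obtain ⟨y, hy⟩ := hE p.1
  exact ((hy.prod (LocSame.refl p.2)).eucAt).2 (eucAt_prod hn _)

/-- upper side in `E × ℝ` -/
lemma locSame_upper {S : Set (E × ℝ)} {e : E} {t : ℝ} {O : Set (E × ℝ)} (hO : IsOpen O)
    (hx : (e, t) ∈ O) (h : ∀ p ∈ O, p ∈ S ↔ t ≤ p.2) (hS : (e, t) ∈ S) :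
    LocSame (⟨(e, t), hS⟩ : S) ((e, ⟨0, le_refl _⟩) : E × {t : ℝ // 0 ≤ t}) := by
  have h1 := locSame_of_inter (S' := {p : E × ℝ | t ≤ p.2}) hO hx h hS (le_refl t)
  let φ : {p : E × ℝ | t ≤ p.2} ≃ₜ E × {t : ℝ // 0 ≤ t} :=
    { toFun := fun z => (z.1.1, ⟨z.1.2 - t, sub_nonneg.2 z.2⟩)
      invFun := fun z => ⟨(z.1, z.2 + t), by simpa using z.2.2⟩
      left_inv := fun z => by ext <;> simp
      right_inv := fun y => by ext <;> simp
      continuous_toFun := by fun_prop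
      continuous_invFun := by fun_prop }
  have h2 := φ.locSame ⟨(e, t), le_refl t⟩
  have h3 : φ ⟨(e, t), le_refl t⟩ = (e, ⟨0, le_refl _⟩) := by ext <;> simp [φ]
  rw [h3] at h2
  exact h1.trans h2

lemma locSame_lower {S : Set (E × ℝ)} {e : E} {t : ℝ} {O : Set (E × ℝ)} (hO : IsOpen O)
    (hx : (e, t) ∈ O) (h : ∀ p ∈ O, p ∈ S ↔ p.2 ≤ t) (hS : (e, t) ∈ S) :
    LocSame (⟨(e, t), hS⟩ : S) ((e, ⟨0, le_refl _⟩) : E × {t : ℝ // 0 ≤ t}) := by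
  let ρ : E × ℝ ≃ₜ E × ℝ := (Homeomorph.refl E).prodCongr (Homeomorph.neg ℝ)
  have h1 := locSame_image ρ hS (mem_image_of_mem _ hS)
  refine h1.trans (locSame_upper (O := ρ '' O) (ρ.isOpenMap _ hO) (mem_image_of_mem _ hx) ?_ _)
  rintro _ ⟨p, hp, rfl⟩
  have := h p hp
  simp [this]
  simp [ρ]

/-- the boundary of `E × [0,1]`. -/
lemma eucAt_cyl (hn : 1 ≤ n) (hP : PP n) (hE : LocEuc1 n E) (p : E × ↥(Icc (0 : ℝ) 1)) :
    ¬ EucAt n p ↔ ((p.2 : ℝ) = 0 ∨ (p.2 : ℝ) = 1) := by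
  let φ : E × ↥(Icc (0 : ℝ) 1) ≃ₜ {q : E × ℝ | q.2 ∈ Icc (0 : ℝ) 1} :=
    { toFun := fun z => ⟨(z.1, z.2), z.2.2⟩
      invFun := fun z => (z.1.1, ⟨z.1.2, z.2⟩)
      left_inv := fun z => rfl
      right_inv := fun y => rfl
      continuous_toFun := by fun_prop
      continuous_invFun := by fun_prop }
  rw [(φ.locSame p).eucAt]
  obtain ⟨e, s, hs⟩ := p
  have hφ : φ (e, ⟨s, hs⟩) = ⟨(e, s), hs⟩ := rfl
  rw [hφ]
  constructor
  · intro h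
    by_contra h0
    push Not at h0
    have h1 : 0 < s := lt_of_le_of_ne hs.1 (Ne.symm h0.1)
    have h2 : s < 1 := lt_of_le_of_ne hs.2 h0.2
    apply h
    have := locSame_of_nhds (S := {q : E × ℝ | q.2 ∈ Icc (0 : ℝ) 1})
      (O := Prod.snd ⁻¹' (Ioo (0 : ℝ) 1)) (x := (e, s)) (isOpen_Ioo.preimage continuous_snd)
      ⟨h1, h2⟩ (fun q hq => ⟨hq.1.le, hq.2.le⟩) hs
    exact this.eucAt.2 (eucAt_E hn hE _)
  · rintro (h | h)
    · simp only at h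
      subst h
      have := locSame_upper (S := {q : E × ℝ | q.2 ∈ Icc (0 : ℝ) 1}) (e := e) (t := 0)
        (O := Prod.snd ⁻¹' (Iio (1 : ℝ))) (isOpen_Iio.preimage continuous_snd) (by simp)
        (by intro p hp; have : p.2 < 1 := hp; simp [this.le]) hs
      rw [this.eucAt]; exact not_eucAt_zero hP hE e
    · simp only at h
      subst h
      have := locSame_lower (S := {q : E × ℝ | q.2 ∈ Icc (0 : ℝ) 1}) (e := e) (t := 1)
        (O := Prod.snd ⁻¹' (Ioi (0 : ℝ))) (isOpen_Ioi.preimage continuous_snd) (by simp)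
        (by intro p hp; have : 0 < p.2 := hp; simp [this.le]) hs
      rw [this.eucAt]; exact not_eucAt_zero hP hE e

lemma locConn (hE : LocEuc1 n E) : LocallyConnectedSpace E := by
  rw [locallyConnectedSpace_iff_subsets_isOpen_isConnected]
  intro x U hU
  obtain ⟨y, e, he, hy⟩ := hE x
  have h1 : e.symm ⁻¹' U ∈ 𝓝 (e x) := by
    apply (e.symm.continuousAt (by simpa using e.map_source he)).preimage_mem_nhds
    rw [e.left_inv he]; exact hU
  have h2 : e.symm ⁻¹' U ∩ e.target ∈ 𝓝 (e x) :=
    Filter.inter_mem h1 (e.open_target.mem_nhds (e.map_source he))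
  obtain ⟨r, hr, hb⟩ := Metric.mem_nhds_iff.1 h2
  refine ⟨e.symm '' Metric.ball (e x) r, ?_, ?_, ?_, ?_⟩
  · rintro _ ⟨z, hz, rfl⟩; exact (hb hz).1
  · exact e.symm.isOpen_image_of_subset_source Metric.isOpen_ball (fun z hz => (hb hz).2)
  · exact ⟨e x, Metric.mem_ball_self hr, e.left_inv he⟩
  · refine ((convex_ball (e x) r).isConnected ⟨e x, Metric.mem_ball_self hr⟩).image _ ?_
    exact e.symm.continuousOn.mono (fun z hz => (hb hz).2)

end model

section dyn
variable {M : Type*} [TopologicalSpace M]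

lemma homeo_iter (q : M ≃ₜ M) (j : ℕ) : ∃ F : M ≃ₜ M, ⇑F = q^[j] ∧ ⇑F.symm = q.symm^[j] := by
  induction j with
  | zero => exact ⟨Homeomorph.refl M, rfl, rfl⟩
  | succ j ih =>
    obtain ⟨F, h1, h2⟩ := ih
    refine ⟨q.trans F, ?_, ?_⟩
    · funext x; simp [Function.iterate_succ_apply, h1]
    · funext x; simp [Function.iterate_succ_apply', h2]

lemma omega_image (g : M ≃ₜ M) (U : Set M) : g '' omegaSet g U = omegaSet g U := by
  have hC : ∀ n : ℕ, g '' closure (⋃ (k : ℕ) (_ : n ≤ k), g^[k] '' U) =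
      closure (⋃ (k : ℕ) (_ : n + 1 ≤ k), g^[k] '' U) := by
    intro n
    rw [g.image_closure]
    congr 1
    ext x
    simp only [mem_image, mem_iUnion, exists_prop]
    constructor
    · rintro ⟨_, ⟨k, hk, u, hu, rfl⟩, rfl⟩
      exact ⟨k + 1, by omega, u, hu, Function.iterate_succ_apply' _ _ _⟩
    · rintro ⟨k, hk, u, hu, rfl⟩
      obtain ⟨k, rfl⟩ : ∃ k', k = k' + 1 := ⟨k - 1, by omega⟩
      exact ⟨_, ⟨k, by omega, u, hu, rfl⟩, (Function.iterate_succ_apply' _ _ _).symm⟩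
  have hmono : ∀ n : ℕ, closure (⋃ (k : ℕ) (_ : n + 1 ≤ k), g^[k] '' U) ⊆
      closure (⋃ (k : ℕ) (_ : n ≤ k), g^[k] '' U) := by
    intro n
    apply closure_mono
    intro x hx
    simp only [mem_iUnion, exists_prop] at hx ⊢
    obtain ⟨k, hk, h⟩ := hx
    exact ⟨k, by omega, h⟩
  ext x
  unfold omegaSet
  simp only [mem_image, mem_iInter]
  constructor
  · rintro ⟨y, hy, rfl⟩ n hn
    apply hmono
    rw [← hC]
    exact mem_image_of_mem _ (hy n hn)
  · intro h
    refine ⟨g.symm x, fun n hn => ?_, by simp⟩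
    have := h (n + 1) (by omega)
    rw [← hC] at this
    obtain ⟨y, hy, rfl⟩ := this
    simpa using hy

lemma attr_trap [T2Space M] [LocallyCompactSpace M] {g : M ≃ₜ M} {K : Set M}
    (h : IsAttractor g K) : g '' K = K ∧ ∃ V' ∈ 𝓝ˢ K, ∀ O : Set M, IsOpen O → K ⊆ O →
      ∃ n0 : ℕ, ∀ m ≥ n0, g^[m] '' V' ⊆ O := by
  obtain ⟨hK, U, hU, hKU⟩ := h
  have hinv : g '' K = K := by rw [hKU]; exact omega_image g U
  refine ⟨hinv, ?_⟩
  obtain ⟨V, hVc, hKV, hVU⟩ := exists_compact_between hK isOpen_interior (subset_interior_iff_mem_nhdsSet.2 hU)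
  have hVU : V ⊆ U := hVU.trans interior_subset
  set C : ℕ → Set M := fun n => closure (⋃ (k : ℕ) (_ : n ≤ k), g^[k] '' U) with hCdef
  have hanti : Antitone C := by
    intro a b hab
    apply closure_mono
    intro x hx
    simp only [mem_iUnion, exists_prop] at hx ⊢
    obtain ⟨k, hk, h⟩ := hx
    exact ⟨k, by omega, h⟩
  have hsub : ∀ O : Set M, IsOpen O → K ⊆ O → ∃ n, C n ∩ V ⊆ O := by
    intro O hO hKO
    obtain ⟨i, hi⟩ := exists_subset_nhds_of_isCompact' (V := fun i : ℕ => C (i + 1) ∩ V) (U := O)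
      (Antitone.directed_ge (fun a b hab =>
        inter_subset_inter_left _ (hanti (by omega))))
      (fun i => hVc.inter_left isClosed_closure) (fun i => isClosed_closure.inter hVc.isClosed)
      (by
        intro x hx
        apply hO.mem_nhds
        apply hKO
        rw [hKU]
        simp only [mem_iInter] at hx
        unfold omegaSet
        simp only [mem_iInter]
        intro n hn
        have := (hx (n - 1)).1
        rwa [Nat.sub_add_cancel hn] at this)
    exact ⟨_, hi⟩
  have hmem : ∀ x ∈ U, ∀ n m, n ≤ m → g^[m] x ∈ C n := by
    intro x hx n m hnm
    apply subset_closure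
    simp only [mem_iUnion, exists_prop]
    exact ⟨m, hnm, x, hx, rfl⟩
  have hKit : ∀ m : ℕ, ∀ x ∈ K, g^[m] x ∈ K := by
    intro m
    induction m with
    | zero => intro x hx; exact hx
    | succ m ih => 
      intro x hx
      rw [Function.iterate_succ_apply]
      exact ih _ (by rw [← hinv]; exact mem_image_of_mem _ hx)
  obtain ⟨n, hn⟩ := hsub (interior V ∩ g ⁻¹' interior V)
    (isOpen_interior.inter (isOpen_interior.preimage g.continuous))
    (fun x hx => ⟨hKV hx, hKV (hKit 1 x hx)⟩)
  let V' : Set M := ⋂ i ∈ Finset.range (n + 1), g^[i] ⁻¹' interior V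
  have hV'o : IsOpen V' :=
    isOpen_biInter_finset (fun i _ => isOpen_interior.preimage (g.continuous.iterate i))
  have hV'K : K ⊆ V' := by
    intro x hx
    simp only [V', mem_iInter]
    intro i _
    exact hKV (hKit i x hx)
  have hV'U : V' ⊆ U := by
    intro x hx
    simp only [V', mem_iInter] at hx
    exact hVU (interior_subset (hx 0 (by simp)))
  have hV'V : ∀ x ∈ V', ∀ m, g^[m] x ∈ V := by
    intro x hx m
    induction m with
    | zero =>
      simp only [V', mem_iInter] at hx
      exact interior_subset (hx 0 (by simp))
    | succ m ih =>
      by_cases hm : m + 1 < n + 1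
      · simp only [V', mem_iInter] at hx
        exact interior_subset (hx (m + 1) (by simpa using hm))
      · rw [Function.iterate_succ_apply']
        exact interior_subset (hn ⟨hmem x (hV'U hx) n m (by omega), ih⟩).2
  refine ⟨V', hV'o.mem_nhdsSet.2 hV'K, fun O hO hKO => ?_⟩
  obtain ⟨n', hn'⟩ := hsub O hO hKO
  refine ⟨n', fun m hm => ?_⟩
  rintro _ ⟨x, hx, rfl⟩
  exact hn' ⟨hmem x (hV'U hx) n' m hm, hV'V x hx m⟩

end dyn

section glue
variable {M : Type*} [TopologicalSpace M] [T2Space M] {E : Type*} [TopologicalSpace E]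
  [CompactSpace E]

lemma match_homeo (a b : E → M) (ha : Continuous a) (hb : Continuous b)
    (hai : Function.Injective a) (hbi : Function.Injective b) (hr : range a = range b) :
    ∃ sg : E ≃ₜ E, ∀ x, a x = b (sg x) := by
  let ea := (ha.isClosedEmbedding hai).isEmbedding.toHomeomorph
  let eb := (hb.isClosedEmbedding hbi).isEmbedding.toHomeomorph
  refine ⟨(ea.trans (Homeomorph.setCongr hr)).trans eb.symm, fun x => ?_⟩
  have : eb (eb.symm (Homeomorph.setCongr hr (ea x))) = Homeomorph.setCongr hr (ea x) := by simp
  have := congrArg Subtype.val this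
  exact this.symm

lemma glue (q : M ≃ₜ M) (Z Zo : Set M) (hZ : IsClosed Z) (hqZ : q '' Z ⊆ Zo) (hZo : Zo ⊆ Z)
    (β : E × ℝ → M) (hβ : Continuous β) (hinj : InjOn β (univ ×ˢ Icc 0 1))
    (hr : β '' (univ ×ˢ Icc 0 1) = Z \ q '' Zo)
    (h0 : range (fun e => β (e, 0)) = Z \ Zo)
    (h1 : range (fun e => β (e, 1)) = q '' (Z \ Zo)) :
    Nonempty (E × ↥(Ici (0 : ℝ)) ≃ₜ ↥(Z \ ⋂ j : ℕ, q^[j] '' Z)) := by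
  obtain ⟨sg, hsg⟩ := match_homeo (fun e => q (β (e, 0))) (fun e => β (e, 1)) (by fun_prop)
    (by fun_prop)
    (by
      intro x y hxy
      have := hinj (x₁ := (x, 0)) (x₂ := (y, 0)) (by simp) (by simp) (q.injective hxy)
      exact (Prod.ext_iff.1 this).1)
    (by
      intro x y hxy
      have := hinj (x₁ := (x, 1)) (x₂ := (y, 1)) (by simp) (by simp) hxy
      exact (Prod.ext_iff.1 this).1)
    (by rw [h1, ← h0, ← range_comp]; rfl)
  let P : ℕ → E × ↥(Ici (0 : ℝ)) → M := fun j p => q^[j] (β (sg.symm^[j] p.1, p.2 - j))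
  have hPc : ∀ j, Continuous (P j) := by
    intro j
    have h2 := q.continuous.iterate j
    have h3 := sg.symm.continuous.iterate j
    exact h2.comp (hβ.comp ((h3.comp continuous_fst).prodMk (by fun_prop)))
  let Φ : E × ↥(Ici (0 : ℝ)) → M := fun p => P ⌊(p.2 : ℝ)⌋₊ p
  have hΦP : ∀ j : ℕ, ∀ p : E × ↥(Ici (0 : ℝ)), (p.2 : ℝ) ∈ Icc (j : ℝ) (j + 1) → Φ p = P j p := by
    intro j p hp
    rcases eq_or_lt_of_le hp.2 with h | h
    · have hfl : ⌊(p.2 : ℝ)⌋₊ = j + 1 := by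
        rw [h]; exact_mod_cast Nat.floor_natCast (R := ℝ) (j + 1)
      simp only [Φ, hfl, P]
      rw [h, Function.iterate_succ_apply, Function.iterate_succ_apply']
      have := hsg (sg.symm (sg.symm^[j] p.1))
      simp only [Homeomorph.apply_symm_apply] at this
      push_cast
      simp only [sub_self, add_sub_cancel_left]
      rw [this]
    · have hfl : ⌊(p.2 : ℝ)⌋₊ = j := by
        rw [Nat.floor_eq_iff p.2.2]; exact ⟨hp.1, h⟩
      simp only [Φ, hfl]
  have hfl : ∀ p : E × ↥(Ici (0 : ℝ)), (p.2 : ℝ) ∈ Icc ((⌊(p.2 : ℝ)⌋₊ : ℕ) : ℝ) (⌊(p.2 : ℝ)⌋₊ + 1) :=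
    fun p => ⟨Nat.floor_le p.2.2, (Nat.lt_floor_add_one _).le⟩
  have hΦc : Continuous Φ := by
    refine LocallyFinite.continuous (f := fun j : ℕ => {p : E × ↥(Ici (0 : ℝ)) |
      (p.2 : ℝ) ∈ Icc (j : ℝ) (j + 1)}) ?_ ?_ ?_ ?_
    · intro p
      refine ⟨{x | (x.2 : ℝ) < p.2 + 1}, ?_, ?_⟩
      · apply IsOpen.mem_nhds
        · exact isOpen_lt (by fun_prop) (by fun_prop)
        · simp
      · apply (Set.finite_Iic (⌈(p.2 : ℝ) + 1⌉₊)).subset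
        rintro j ⟨x, hx1, hx2⟩
        have h1 := hx1.1
        have h2 : (x.2 : ℝ) < p.2 + 1 := hx2
        have h3 := Nat.le_ceil ((p.2 : ℝ) + 1)
        have : (j : ℝ) ≤ (⌈(p.2 : ℝ) + 1⌉₊ : ℝ) := by linarith
        exact_mod_cast this
    · ext p
      simp only [mem_iUnion, mem_univ, iff_true]
      exact ⟨_, hfl p⟩
    · intro j
      exact isClosed_Icc.preimage (by fun_prop : Continuous fun p : E × ↥(Ici (0 : ℝ)) => (p.2 : ℝ))
    · intro j
      exact (hPc j).continuousOn.congr (hΦP j)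
  let S : ℕ → Set M := fun j => q^[j] '' Z
  have hSs : ∀ j, S (j + 1) = q^[j] '' (q '' Z) := by
    intro j
    simp only [S, Function.iterate_succ, image_comp]
  have hSanti : Antitone S := by
    apply antitone_nat_of_succ_le
    intro j
    rw [hSs]
    exact image_mono (hqZ.trans hZo)
  have hqinj : ∀ j, Function.Injective (q^[j]) := fun j => q.injective.iterate j
  have hβZ : ∀ e : E, ∀ s ∈ Icc (0 : ℝ) 1, β (e, s) ∈ Z := by
    intro e s hs
    have : β (e, s) ∈ Z \ q '' Zo := by rw [← hr]; exact mem_image_of_mem _ ⟨mem_univ _, hs⟩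
    exact this.1
  have hβq : ∀ e : E, ∀ s ∈ Icc (0 : ℝ) 1, β (e, s) ∈ q '' Z → s = 1 := by
    intro e s hs hm
    have h2 : β (e, s) ∈ Z \ q '' Zo := by rw [← hr]; exact mem_image_of_mem _ ⟨mem_univ _, hs⟩
    have h3 : β (e, s) ∈ q '' (Z \ Zo) := by
      rw [image_sdiff q.injective]; exact ⟨hm, h2.2⟩
    rw [← h1] at h3
    obtain ⟨e', he'⟩ := h3
    have := hinj (x₁ := (e', 1)) (x₂ := (e, s)) (by simp) ⟨mem_univ _, hs⟩ he'
    exact (Prod.ext_iff.1 this).2.symm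
  have hfrac : ∀ p : E × ↥(Ici (0 : ℝ)), (p.2 : ℝ) - ⌊(p.2 : ℝ)⌋₊ ∈ Ico (0 : ℝ) 1 := by
    intro p
    have h1 := Nat.floor_le (mem_Ici.1 p.2.2)
    have h2 := Nat.lt_floor_add_one (p.2 : ℝ)
    constructor <;> linarith
  have hlev : ∀ p, Φ p ∈ S ⌊(p.2 : ℝ)⌋₊ := fun p =>
    mem_image_of_mem _ (hβZ _ _ (Ico_subset_Icc_self (hfrac p)))
  have hlev' : ∀ p, Φ p ∉ S (⌊(p.2 : ℝ)⌋₊ + 1) := by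
    intro p hp
    rw [hSs] at hp
    have h2 : β (sg.symm^[⌊(p.2 : ℝ)⌋₊] p.1, (p.2 : ℝ) - ⌊(p.2 : ℝ)⌋₊) ∈ q '' Z :=
      (hqinj _).mem_set_image.1 hp
    have := hβq _ _ (Ico_subset_Icc_self (hfrac p)) h2
    exact (hfrac p).2.ne this
  have hΦinj : Function.Injective Φ := by
    intro p p' h
    have hj : ⌊(p.2 : ℝ)⌋₊ = ⌊(p'.2 : ℝ)⌋₊ := by
      rcases lt_trichotomy ⌊(p.2 : ℝ)⌋₊ ⌊(p'.2 : ℝ)⌋₊ with hlt | he | hlt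
      · exact absurd (h ▸ hSanti hlt (hlev p')) (hlev' p)
      · exact he
      · exact absurd (h ▸ hSanti hlt (hlev p)) (hlev' p')
    have h2 : q^[⌊(p.2 : ℝ)⌋₊] (β (sg.symm^[⌊(p.2 : ℝ)⌋₊] p.1, (p.2 : ℝ) - ⌊(p.2 : ℝ)⌋₊)) =
      q^[⌊(p'.2 : ℝ)⌋₊] (β (sg.symm^[⌊(p'.2 : ℝ)⌋₊] p'.1, (p'.2 : ℝ) - ⌊(p'.2 : ℝ)⌋₊)) := h
    rw [← hj] at h2
    have h3 := hinj ⟨mem_univ _, Ico_subset_Icc_self (hfrac p)⟩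
      ⟨mem_univ _, by have := Ico_subset_Icc_self (hfrac p'); rwa [← hj] at this⟩ (hqinj _ h2)
    rw [Prod.ext_iff] at h3
    refine Prod.ext (sg.symm.injective.iterate _ h3.1) (Subtype.ext ?_)
    have := h3.2
    simp only at this
    linarith
  have hΦr : ∀ p, Φ p ∈ Z \ ⋂ j : ℕ, S j := by
    intro p
    refine ⟨?_, fun h => hlev' p (mem_iInter.1 h _)⟩
    have := hSanti (Nat.zero_le _) (hlev p)
    simpa [S] using this
  have hsurj : ∀ x ∈ Z \ ⋂ j : ℕ, S j, ∃ p, Φ p = x := by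
    intro x hx
    have hex : ∃ j, x ∉ S j := by
      by_contra hcon
      push Not at hcon
      exact hx.2 (mem_iInter.2 hcon)
    classical
    have hJ := Nat.find_spec hex
    have hJmin : ∀ m, m < Nat.find hex → x ∈ S m := fun m hm => not_not.1 (Nat.find_min hex hm)
    obtain ⟨j, hj⟩ : ∃ j, Nat.find hex = j + 1 := by
      refine ⟨Nat.find hex - 1, ?_⟩
      have : Nat.find hex ≠ 0 := by
        intro h0
        rw [h0] at hJ
        exact hJ (by simpa [S] using hx.1)
      omega
    rw [hj] at hJ
    obtain ⟨z, hz, hzx⟩ := hJmin j (by omega)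
    have hzq : z ∉ q '' Z := by
      intro h
      apply hJ
      rw [hSs, ← hzx]
      exact mem_image_of_mem _ h
    have : z ∈ β '' (univ ×ˢ Icc 0 1) := by
      rw [hr]
      exact ⟨hz, fun h => hzq (image_mono hZo h)⟩
    obtain ⟨⟨y, s⟩, ⟨_, hs⟩, hys⟩ := this
    simp only at hs
    have hp0 : (0 : ℝ) ≤ j + s := by have := hs.1; positivity
    refine ⟨(sg^[j] y, ⟨j + s, hp0⟩), ?_⟩
    rw [hΦP j _ ⟨by simpa using hs.1, by simpa using hs.2⟩]
    simp only [P]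
    have : sg.symm^[j] (sg^[j] y) = y :=
      (Function.LeftInverse.iterate sg.symm_apply_apply j) y
    rw [this, add_sub_cancel_left, hys, hzx]
  let eqv : E × ↥(Ici (0 : ℝ)) ≃ ↥(Z \ ⋂ j : ℕ, S j) :=
    Equiv.ofBijective (fun p => ⟨Φ p, hΦr p⟩)
      ⟨fun p p' h => hΦinj (congrArg Subtype.val h), fun x => by
        obtain ⟨p, hp⟩ := hsurj x x.2
        exact ⟨p, Subtype.ext hp⟩⟩
  refine ⟨eqv.toHomeomorphOfContinuousClosed (hΦc.subtype_mk _) ?_⟩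
  intro A hA
  rw [← closure_subset_iff_isClosed]
  intro y hy
  obtain ⟨J, hJ⟩ : ∃ J, (y : M) ∉ S J := by
    by_contra hcon
    push Not at hcon
    exact y.2.2 (mem_iInter.2 hcon)
  have hSc : IsClosed (S J) := by
    obtain ⟨F, hF, -⟩ := homeo_iter q J
    simp only [S, ← hF]
    exact F.isClosedMap _ hZ
  have hO : IsOpen {z : ↥(Z \ ⋂ j : ℕ, S j) | (z : M) ∉ S J} :=
    hSc.isOpen_compl.preimage continuous_subtype_val
  have h2 : y ∈ closure (eqv '' A ∩ {z : ↥(Z \ ⋂ j : ℕ, S j) | (z : M) ∉ S J}) :=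
    hO.closure_inter (s := eqv '' A) ⟨hy, hJ⟩
  have hcomp : IsCompact {p : E × ↥(Ici (0 : ℝ)) | (p.2 : ℝ) ≤ J} := by
    have : {p : E × ↥(Ici (0 : ℝ)) | (p.2 : ℝ) ≤ J} =
      (univ : Set E) ×ˢ {u : ↥(Ici (0 : ℝ)) | (u : ℝ) ≤ J} := by ext; simp
    rw [this]
    refine isCompact_univ.prod ?_
    rw [Subtype.isCompact_iff]
    convert (isCompact_Icc : IsCompact (Icc (0 : ℝ) J)) using 1
    ext u
    simp only [mem_image, mem_ofPred_eq, Subtype.exists, mem_Ici, exists_and_left, exists_prop,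
      exists_eq_right_right, mem_Icc]
    tauto
  have hcl : IsClosed (eqv '' (A ∩ {p : E × ↥(Ici (0 : ℝ)) | (p.2 : ℝ) ≤ J})) :=
    ((hcomp.inter_left hA).image (hΦc.subtype_mk _)).isClosed
  have hsubset : eqv '' A ∩ {z : ↥(Z \ ⋂ j : ℕ, S j) | (z : M) ∉ S J} ⊆
      eqv '' (A ∩ {p : E × ↥(Ici (0 : ℝ)) | (p.2 : ℝ) ≤ J}) := by
    rintro _ ⟨⟨p, hp, rfl⟩, hz⟩
    refine mem_image_of_mem _ ⟨hp, ?_⟩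
    by_contra hcon
    simp only [mem_ofPred_eq, not_le] at hcon
    exact hz (hSanti (Nat.le_floor hcon.le) (hlev p))
  exact image_mono inter_subset_left (hcl.closure_subset_iff.2 hsubset h2)

end glue


lemma mem_subsetBoundary {M : Type*} [TopologicalSpace M] {n : ℕ} {S : Set M} {x : M} :
    x ∈ subsetBoundary n S ↔ ∃ h : x ∈ S, ¬ EucAt n (⟨x, h⟩ : S) := by
  constructor
  · rintro ⟨y, hy, rfl⟩; exact ⟨y.2, hy⟩
  · rintro ⟨h, hy⟩; exact ⟨⟨x, h⟩, hy, rfl⟩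

lemma subsetBoundary_image {M : Type*} [TopologicalSpace M] {n : ℕ} {S : Set M} (F : M ≃ₜ M) :
    subsetBoundary n (F '' S) = F '' subsetBoundary n S := by
  ext x
  rw [mem_subsetBoundary]
  constructor
  · rintro ⟨⟨y, hy, rfl⟩, h⟩
    refine mem_image_of_mem _ (mem_subsetBoundary.2 ⟨hy, ?_⟩)
    rwa [(locSame_image F hy (mem_image_of_mem _ hy)).eucAt]
  · rintro ⟨y, hy, rfl⟩
    obtain ⟨hy, h⟩ := mem_subsetBoundary.1 hy
    refine ⟨mem_image_of_mem _ hy, ?_⟩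
    rwa [← (locSame_image F hy (mem_image_of_mem _ hy)).eucAt]

lemma mfld_image {M : Type*} [TopologicalSpace M] {n : ℕ} {S : Set M} (F : M ≃ₜ M)
    (h : IsCompactMfldBdry n S) : IsCompactMfldBdry n (F '' S) := by
  refine ⟨h.1.image F.continuous, ?_⟩
  rintro ⟨_, y, hy, rfl⟩
  exact ((locSame_image F hy (mem_image_of_mem _ hy)).halfAt).1 (h.2 ⟨y, hy⟩)

section PCsec
variable {M : Type*} [TopologicalSpace M] [T2Space M] {E : Type*} [TopologicalSpace E]
  [CompactSpace E]

structure IsColl (c : E × ℝ → M) (N K : Set M) (T : ℝ) : Prop where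
  cont : Continuous c
  inj : InjOn c (univ ×ˢ Ici 0)
  im : c '' (univ ×ˢ Ici 0) = N \ K
  emb : IsEmbedding (fun p : E × ↥(Ici (0 : ℝ)) => c (p.1, p.2))
  KN : K ⊆ interior N
  Kc : IsCompact K
  Nc : IsCompact N
  T0 : 0 ≤ T
  hT : N \ c '' (univ ×ˢ Icc 0 T) ⊆ interior N

def Nt (c : E × ℝ → M) (K : Set M) (t : ℝ) : Set M := K ∪ c '' (univ ×ˢ Ici t)
def No (c : E × ℝ → M) (K : Set M) (t : ℝ) : Set M := K ∪ c '' (univ ×ˢ Ioi t)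

namespace IsColl
variable {c : E × ℝ → M} {N K : Set M} {T : ℝ} {n : ℕ}

lemma notK (hc : IsColl c N K T) {e : E} {s : ℝ} (hs : 0 ≤ s) : c (e, s) ∈ N \ K := by
  rw [← hc.im]; exact mem_image_of_mem _ ⟨mem_univ _, hs⟩

lemma eq_of (hc : IsColl c N K T) {e e' : E} {s s' : ℝ} (hs : 0 ≤ s) (hs' : 0 ≤ s')
    (h : c (e, s) = c (e', s')) : e = e' ∧ s = s' := by
  have := hc.inj (x₁ := (e, s)) (x₂ := (e', s')) ⟨mem_univ _, hs⟩ ⟨mem_univ _, hs'⟩ h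
  simpa using this

lemma ex_of (hc : IsColl c N K T) {x : M} (hx : x ∈ N) (hK : x ∉ K) :
    ∃ e s, 0 ≤ s ∧ c (e, s) = x := by
  have : x ∈ c '' (univ ×ˢ Ici 0) := by rw [hc.im]; exact ⟨hx, hK⟩
  obtain ⟨⟨e, s⟩, ⟨_, hs⟩, rfl⟩ := this
  exact ⟨e, s, hs, rfl⟩

lemma KN' (hc : IsColl c N K T) : K ⊆ N := hc.KN.trans interior_subset

lemma mem_Nt (hc : IsColl c N K T) {e : E} {s t : ℝ} (hs : 0 ≤ s) (ht : 0 ≤ t) :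
    c (e, s) ∈ Nt c K t ↔ t ≤ s := by
  constructor
  · rintro (h | ⟨⟨e', s'⟩, ⟨_, hs'⟩, h⟩)
    · exact absurd h (hc.notK hs).2
    · have hs' : t ≤ s' := hs'
      rw [← (hc.eq_of (ht.trans hs') hs h).2]; exact hs'
  · intro h
    exact Or.inr (mem_image_of_mem _ ⟨mem_univ _, h⟩)

lemma mem_No (hc : IsColl c N K T) {e : E} {s t : ℝ} (hs : 0 ≤ s) (ht : 0 ≤ t) :
    c (e, s) ∈ No c K t ↔ t < s := by
  constructor
  · rintro (h | ⟨⟨e', s'⟩, ⟨_, hs'⟩, h⟩)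
    · exact absurd h (hc.notK hs).2
    · have hs' : t < s' := hs'
      rw [← (hc.eq_of (ht.trans hs'.le) hs h).2]; exact hs'
  · intro h
    exact Or.inr (mem_image_of_mem _ ⟨mem_univ _, h⟩)

lemma Nt_sub (hc : IsColl c N K T) {t : ℝ} (ht : 0 ≤ t) : Nt c K t ⊆ N := by
  rintro x (h | ⟨⟨e', s'⟩, ⟨_, hs'⟩, rfl⟩)
  · exact hc.KN' h
  · exact (hc.notK (ht.trans hs')).1

lemma No_sub_Nt {t : ℝ} : No c K t ⊆ Nt c K t := 
  union_subset_union_right _ (image_mono (prod_mono_right Ioi_subset_Ici_self))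

lemma Nt_sub_No {t s : ℝ} (h : t < s) : Nt c K s ⊆ No c K t :=
  union_subset_union_right _ (image_mono (prod_mono_right (Ici_subset_Ioi.2 h)))

lemma No_eq (hc : IsColl c N K T) {t : ℝ} (ht : 0 ≤ t) :
    No c K t = N \ c '' (univ ×ˢ Icc 0 t) := by
  ext x
  constructor
  · intro hx
    refine ⟨hc.Nt_sub ht (No_sub_Nt hx), ?_⟩
    rintro ⟨⟨e, s⟩, ⟨_, hs⟩, rfl⟩
    exact absurd ((hc.mem_No hs.1 ht).1 hx) (not_lt.2 hs.2)
  · rintro ⟨hx, hx'⟩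
    by_cases hK : x ∈ K
    · exact Or.inl hK
    · obtain ⟨e, s, hs, rfl⟩ := hc.ex_of hx hK
      rw [hc.mem_No hs ht]
      by_contra hcon
      exact hx' (mem_image_of_mem _ ⟨mem_univ _, hs, not_lt.1 hcon⟩)

lemma No_open (hc : IsColl c N K T) {t : ℝ} (ht : T ≤ t) : IsOpen (No c K t) := by
  have h0 := hc.T0.trans ht
  have : No c K t = interior N \ c '' (univ ×ˢ Icc 0 t) := by
    rw [hc.No_eq h0]
    apply Subset.antisymm
    · rintro x ⟨h1, h2⟩
      exact ⟨hc.hT ⟨h1, fun h => h2 (image_mono (prod_mono_right (Icc_subset_Icc_right ht)) h)⟩, h2⟩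
    · exact sdiff_subset_sdiff_left interior_subset
  rw [this]
  exact isOpen_interior.sdiff ((isCompact_univ.prod isCompact_Icc).image hc.cont).isClosed

lemma Nt_compact (hc : IsColl c N K T) {t : ℝ} (ht : 0 ≤ t) : IsCompact (Nt c K t) := by
  have ho : IsOpen {p : E × ↥(Ici (0 : ℝ)) | (p.2 : ℝ) < t} :=
    isOpen_lt (by fun_prop) (by fun_prop)
  obtain ⟨O, hO, hOp⟩ := hc.emb.isOpen_iff.1 ho
  have : Nt c K t = N ∩ (O ∩ Kᶜ)ᶜ := by
    ext x
    constructor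
    · intro hx
      refine ⟨hc.Nt_sub ht hx, ?_⟩
      rintro ⟨h1, h2⟩
      obtain ⟨e, s, hs, rfl⟩ := hc.ex_of (hc.Nt_sub ht hx) h2
      rw [hc.mem_Nt hs ht] at hx
      have : ((e, ⟨s, hs⟩) : E × ↥(Ici (0 : ℝ))) ∈ {p : E × ↥(Ici (0 : ℝ)) | (p.2 : ℝ) < t} := by
        rw [← hOp]; exact h1
      exact absurd this (not_lt.2 hx)
    · rintro ⟨h1, h2⟩
      by_cases hK : x ∈ K
      · exact Or.inl hK
      · obtain ⟨e, s, hs, rfl⟩ := hc.ex_of h1 hK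
        rw [hc.mem_Nt hs ht]
        by_contra hcon
        apply h2
        refine ⟨?_, hK⟩
        have : ((e, ⟨s, hs⟩) : E × ↥(Ici (0 : ℝ))) ∈ {p : E × ↥(Ici (0 : ℝ)) | (p.2 : ℝ) < t} :=
          not_le.1 hcon
        rw [← hOp] at this
        exact this
  rw [this]
  exact hc.Nc.inter_right (hO.inter hc.Kc.isClosed.isOpen_compl).isClosed_compl

lemma Nt_small (hc : IsColl c N K T) {O : Set M} (hO : IsOpen O) (hKO : K ⊆ O) :
    ∃ t0, ∀ t ≥ t0, 0 ≤ t → Nt c K t ⊆ O := by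
  obtain ⟨i, hi⟩ := exists_subset_nhds_of_isCompact' (V := fun i : ℕ => Nt c K i) (U := O)
      (Antitone.directed_ge (fun a b hab =>
        union_subset_union_right _ (image_mono (prod_mono_right (Ici_subset_Ici.2
          (by exact_mod_cast hab))))))
      (fun i => hc.Nt_compact (by positivity)) (fun i => (hc.Nt_compact (by positivity)).isClosed)
      (by
        intro x hx
        apply hO.mem_nhds
        apply hKO
        by_contra hK
        simp only [mem_iInter] at hx
        obtain ⟨e, s, hs, rfl⟩ := hc.ex_of (hc.Nt_sub (by positivity) (hx 0)) hK
        obtain ⟨m, hm⟩ := exists_nat_gt s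
        have := (hc.mem_Nt hs (by positivity)).1 (hx m)
        linarith)
  refine ⟨i, fun t ht _ => Subset.trans ?_ hi⟩
  exact union_subset_union_right _ (image_mono (prod_mono_right (Ici_subset_Ici.2 ht)))

lemma interior_Nt (hc : IsColl c N K T) {t : ℝ} (ht : T < t) :
    interior (Nt c K t) = No c K t := by
  have h0 : 0 < t := hc.T0.trans_lt ht
  apply Subset.antisymm
  · intro x hx
    have hx' := interior_subset hx
    by_cases hK : x ∈ K
    · exact Or.inl hK
    · obtain ⟨e, s, hs, rfl⟩ := hc.ex_of (hc.Nt_sub h0.le hx') hK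
      rw [hc.mem_Nt hs h0.le] at hx'
      rw [hc.mem_No hs h0.le]
      refine lt_of_le_of_ne hx' ?_
      rintro rfl
      have hcc : Continuous (fun u : ℝ => c (e, u)) := hc.cont.comp (by fun_prop)
      have h1 : (fun u : ℝ => c (e, u)) ⁻¹' interior (Nt c K t) ∈ 𝓝 t :=
        (isOpen_interior.preimage hcc).mem_nhds hx
      obtain ⟨l, hl, hl2⟩ := exists_Ioc_subset_of_mem_nhds h1 ⟨0, h0⟩
      have hm : max ((l + t) / 2) 0 ∈ Ioc l t :=
        ⟨lt_max_of_lt_left (by linarith [hl]), max_le (by linarith [hl]) h0.le⟩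
      have h2 := interior_subset (hl2 hm)
      rw [hc.mem_Nt (le_max_right _ _) h0.le] at h2
      have : max ((l + t) / 2) 0 < t := max_lt (by linarith [hl]) h0
      linarith
  · exact (hc.No_open ht.le).subset_interior_iff.2 No_sub_Nt

lemma locSame (hc : IsColl c N K T) {S : Set M} {p : E × ℝ} (hp : T < p.2) (hS : c p ∈ S) :
    LocSame (⟨c p, hS⟩ : S) (⟨p, hS⟩ : c ⁻¹' S) := by
  let D : Set (E × ℝ) := {p | T < p.2}
  have hD : IsOpen D := isOpen_lt (by fun_prop) (by fun_prop)
  have hD0 : ∀ d : D, (0 : ℝ) ≤ d.1.2 := fun d => hc.T0.trans (le_of_lt d.2)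
  have hemb : IsEmbedding (fun d : D => c d) := by
    have h1 : IsEmbedding (fun d : D => ((d.1.1, ⟨d.1.2, hD0 d⟩) : E × ↥(Ici (0 : ℝ)))) := by
      refine IsEmbedding.of_comp (g := fun p : E × ↥(Ici (0 : ℝ)) => (p.1, (p.2 : ℝ)))
        (by fun_prop) (by fun_prop) ?_
      exact IsEmbedding.subtypeVal
    exact hc.emb.comp h1
  have hrange : range (fun d : D => c d) = No c K T ∩ Kᶜ := by
    ext x
    constructor
    · rintro ⟨d, rfl⟩
      exact ⟨Or.inr (mem_image_of_mem _ ⟨mem_univ _, d.2⟩), (hc.notK (hD0 d)).2⟩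
    · rintro ⟨h | ⟨q, ⟨_, hq⟩, rfl⟩, h2⟩
      · exact absurd h h2
      · exact ⟨⟨q, hq⟩, rfl⟩
  have hoe : IsOpenEmbedding (fun d : D => c d) := ⟨hemb, by
    rw [hrange]; exact (hc.No_open le_rfl).inter hc.Kc.isClosed.isOpen_compl⟩
  haveI : Nonempty D := ⟨⟨p, hp⟩⟩
  have h1 := locSame_sub (hoe.toOpenPartialHomeomorph) (S := {d : D | c d ∈ S}) (S' := S)
    (by intro x _; rfl) (a := ⟨p, hp⟩) (by simp) hS hS
  have h2 := locSame_sub (TopologicalSpace.Opens.openPartialHomeomorphSubtypeCoe ⟨D, hD⟩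
    ⟨⟨p, hp⟩⟩) (S := {d : D | c d ∈ S}) (S' := c ⁻¹' S)
    (by intro x _; rfl) (a := ⟨p, hp⟩) (by simp) hS hS
  exact h1.symm.trans h2

lemma Nt_edge (hc : IsColl c N K T) {t : ℝ} (ht : T < t) {e : E} (h : c (e, t) ∈ Nt c K t) :
    LocSame (⟨c (e, t), h⟩ : Nt c K t) ((e, ⟨0, le_refl _⟩) : E × {t : ℝ // 0 ≤ t}) := by
  have h0 : 0 < t := hc.T0.trans_lt ht
  refine (hc.locSame (p := (e, t)) ht h).trans (locSame_upper (O := {p | 0 < p.2}) 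
    (isOpen_lt (by fun_prop) (by fun_prop)) h0 ?_ _)
  intro p hp
  exact hc.mem_Nt (le_of_lt hp) h0.le

lemma Nt_mfld (hc : IsColl c N K T) (hn : 1 ≤ n) (hM : LocallyEuclidean n M)
    (hE : LocEuc1 n E) {t : ℝ} (ht : T < t) : IsCompactMfldBdry n (Nt c K t) := by
  have h0 : 0 < t := hc.T0.trans_lt ht
  refine ⟨hc.Nt_compact h0.le, ?_⟩
  rintro ⟨x, hx⟩
  by_cases h : x ∈ No c K t
  · exact eucAt.halfAt hn ((locSame_of_nhds (hc.No_open ht.le) h No_sub_Nt hx).eucAt.2 (hM x))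
  · obtain ⟨e, s, hs, rfl⟩ := hc.ex_of (hc.Nt_sub h0.le hx) (fun hk => h (Or.inl hk))
    rw [hc.mem_No hs h0.le] at h
    have h' := hx
    rw [hc.mem_Nt hs h0.le] at h'
    obtain rfl : s = t := le_antisymm (not_lt.1 h) h'
    exact (hc.Nt_edge ht hx).halfAt.2 (halfAt_zero hE e)

lemma Nt_bdry (hc : IsColl c N K T) (hM : LocallyEuclidean n M) (hP : PP n)
    (hE : LocEuc1 n E) {t : ℝ} (ht : T < t) :
    subsetBoundary n (Nt c K t) = range (fun e => c (e, t)) := by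
  have h0 : 0 < t := hc.T0.trans_lt ht
  ext x
  rw [mem_subsetBoundary]
  constructor
  · rintro ⟨hx, hE⟩
    have h : x ∉ No c K t := fun h =>
      hE ((locSame_of_nhds (hc.No_open ht.le) h No_sub_Nt hx).eucAt.2 (hM x))
    obtain ⟨e, s, hs, rfl⟩ := hc.ex_of (hc.Nt_sub h0.le hx) (fun hk => h (Or.inl hk))
    rw [hc.mem_No hs h0.le] at h
    have h' := hx
    rw [hc.mem_Nt hs h0.le] at h'
    obtain rfl : s = t := le_antisymm (not_lt.1 h) h'
    exact ⟨e, rfl⟩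
  · rintro ⟨e, rfl⟩
    have hx : c (e, t) ∈ Nt c K t := (hc.mem_Nt h0.le h0.le).2 le_rfl
    refine ⟨hx, ?_⟩
    rw [(hc.Nt_edge ht hx).eucAt]
    exact not_eucAt_zero hP hE e

lemma cyl (hc : IsColl c N K T) {a b : ℝ} (ha : 0 ≤ a) (hab : a < b) :
    Nonempty (↥(c '' (univ ×ˢ Icc a b)) ≃ₜ E × ↥(Icc (0 : ℝ) 1)) := by
  let g : E × ↥(Icc (0 : ℝ) 1) → M := fun p => c (p.1, a + (p.2 : ℝ) * (b - a))
  have hg : Continuous g := hc.cont.comp (by fun_prop)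
  have hba : 0 < b - a := sub_pos.2 hab
  have hinj : Function.Injective g := by
    rintro ⟨e, s, hs⟩ ⟨e', s', hs'⟩ h
    obtain ⟨h1, h2⟩ := hc.eq_of (add_nonneg ha (mul_nonneg hs.1 hba.le))
      (add_nonneg ha (mul_nonneg hs'.1 hba.le)) h
    have h3 : s = s' := mul_right_cancel₀ hba.ne' (add_left_cancel h2)
    subst h1 h3; rfl
  have hr : range g = c '' (univ ×ˢ Icc a b) := by
    ext x
    constructor
    · rintro ⟨⟨e, s, hs⟩, rfl⟩
      refine mem_image_of_mem _ ⟨mem_univ _, ?_, ?_⟩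
      · have := mul_nonneg hs.1 hba.le
        simp only; linarith
      · have := mul_le_mul_of_nonneg_right hs.2 hba.le
        simp only; linarith
    · rintro ⟨⟨e, s⟩, ⟨_, hs⟩, rfl⟩
      simp only at hs
      refine ⟨(e, ⟨(s - a) / (b - a), div_nonneg (by linarith [hs.1]) hba.le,
        (div_le_one hba).2 (by linarith [hs.2])⟩), ?_⟩
      simp only [g]
      rw [div_mul_cancel₀ _ hba.ne']
      simp
  exact ⟨((hg.isClosedEmbedding hinj).isEmbedding.toHomeomorph.trans (Homeomorph.setCongr hr)).symm⟩

lemma cyl_bdry (hc : IsColl c N K T) (hM : LocallyEuclidean n M) (hP : PP n)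
    (hE : LocEuc1 n E) {t s : ℝ} (ht : T < t) (hts : t < s) :
    Nonempty (↥(subsetBoundary n (c '' (univ ×ˢ Icc t s))) ≃ₜ E ⊕ E) := by
  have h0 : 0 < t := hc.T0.trans_lt ht
  have hs0 : 0 < s := h0.trans hts
  have hmem : ∀ e u, 0 ≤ u → (c (e, u) ∈ c '' (univ ×ˢ Icc t s) ↔ u ∈ Icc t s) := by
    intro e u hu
    constructor
    · rintro ⟨⟨e', u'⟩, ⟨_, hu'⟩, h⟩
      rw [← (hc.eq_of (h0.le.trans hu'.1) hu h).2]; exact hu'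
    · intro h
      exact mem_image_of_mem _ ⟨mem_univ _, h⟩
  let g : E ⊕ E → M := Sum.elim (fun e => c (e, t)) (fun e => c (e, s))
  have hg : Continuous g := by
    apply Continuous.sumElim
    · exact hc.cont.comp (by fun_prop)
    · exact hc.cont.comp (by fun_prop)
  have hinj : Function.Injective g := by
    rintro (e | e) (e' | e') h
    · rw [(hc.eq_of h0.le h0.le h).1]
    · exact absurd (hc.eq_of h0.le hs0.le h).2 hts.ne
    · exact absurd (hc.eq_of hs0.le h0.le h).2 hts.ne'
    · rw [(hc.eq_of hs0.le hs0.le h).1]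
  have hr : range g = subsetBoundary n (c '' (univ ×ˢ Icc t s)) := by
    ext x
    rw [mem_subsetBoundary]
    constructor
    · rintro ⟨e | e, rfl⟩
      · have hx : c (e, t) ∈ c '' (univ ×ˢ Icc t s) := (hmem e t h0.le).2 ⟨le_rfl, hts.le⟩
        refine ⟨hx, ?_⟩
        have h1 := (hc.locSame (p := (e, t)) ht hx).trans
          (locSame_upper (O := {p | 0 < p.2} ∩ {p | p.2 < s})
          ((isOpen_lt (by fun_prop) (by fun_prop)).inter (isOpen_lt (by fun_prop) (by fun_prop)))
          ⟨h0, hts⟩ (by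
            intro p hp
            have hp2 : p.2 < s := hp.2
            have := hmem p.1 p.2 (le_of_lt hp.1)
            rw [mem_preimage, this, mem_Icc]
            exact ⟨fun h => h.1, fun h => ⟨h, hp2.le⟩⟩) _)
        exact fun h => not_eucAt_zero hP hE e (h1.eucAt.1 h)
      · have hx : c (e, s) ∈ c '' (univ ×ˢ Icc t s) := (hmem e s hs0.le).2 ⟨hts.le, le_rfl⟩
        refine ⟨hx, ?_⟩
        have h1 := (hc.locSame (p := (e, s)) (ht.trans hts) hx).trans
          (locSame_lower (O := {p | t < p.2})
          (isOpen_lt (by fun_prop) (by fun_prop))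
          hts (by
            intro p hp
            have hp2 : t < p.2 := hp
            have := hmem p.1 p.2 (h0.trans hp2).le
            rw [mem_preimage, this, mem_Icc]
            exact ⟨fun h => h.2, fun h => ⟨hp2.le, h⟩⟩) _)
        exact fun h => not_eucAt_zero hP hE e (h1.eucAt.1 h)
    · rintro ⟨⟨⟨e, u⟩, ⟨_, hu⟩, rfl⟩, h⟩
      simp only at hu
      by_cases h1 : u = t
      · subst h1; exact ⟨Sum.inl e, rfl⟩
      by_cases h2 : u = s
      · subst h2; exact ⟨Sum.inr e, rfl⟩
      exfalso
      apply h
      have hu1 : t < u := lt_of_le_of_ne hu.1 (Ne.symm h1)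
      have hu2 : u < s := lt_of_le_of_ne hu.2 h2
      have hu0 := h0.trans hu1
      have hO : IsOpen (No c K t \ Nt c K s) :=
        (hc.No_open ht.le).sdiff (hc.Nt_compact hs0.le).isClosed
      refine (locSame_of_nhds hO ⟨(hc.mem_No hu0.le h0.le).2 hu1, ?_⟩ ?_ _).eucAt.2 (hM _)
      · rw [hc.mem_Nt hu0.le hs0.le]; exact not_le.2 hu2
      · rintro x ⟨hx1, hx2⟩
        obtain ⟨e', u', hu', rfl⟩ := hc.ex_of (hc.Nt_sub h0.le (No_sub_Nt hx1))
          (fun hk => hx2 (Or.inl hk))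
        rw [hc.mem_No hu' h0.le] at hx1
        rw [hc.mem_Nt hu' hs0.le] at hx2
        exact (hmem _ _ hu').2 ⟨hx1.le, (not_le.1 hx2).le⟩
  exact ⟨((hg.isClosedEmbedding hinj).isEmbedding.toHomeomorph.trans (Homeomorph.setCongr hr)).symm⟩

lemma diff_eq (hc : IsColl c N K T) {t s : ℝ} (h0 : 0 ≤ t) (hts : t < s) :
    Nt c K t \ No c K s = c '' (univ ×ˢ Icc t s) := by
  have hs0 := h0.trans hts.le
  ext x
  constructor
  · rintro ⟨hx1, hx2⟩
    obtain ⟨e', u', hu', rfl⟩ := hc.ex_of (hc.Nt_sub h0 hx1) (fun hk => hx2 (Or.inl hk))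
    rw [hc.mem_Nt hu' h0] at hx1
    rw [hc.mem_No hu' hs0, not_lt] at hx2
    exact mem_image_of_mem _ ⟨mem_univ _, hx1, hx2⟩
  · rintro ⟨⟨e, u⟩, ⟨_, hu⟩, rfl⟩
    simp only at hu
    have hu0 := h0.trans hu.1
    exact ⟨(hc.mem_Nt hu0 h0).2 hu.1, fun h => not_lt.2 hu.2 ((hc.mem_No hu0 hs0).1 h)⟩

end IsColl

end PCsec


section PDsec

lemma inj_surj {E : Type*} [TopologicalSpace E] [CompactSpace E] [T2Space E]
    [LocallyConnectedSpace E] (i : E → E) (hi : Continuous i) (hinj : Function.Injective i)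
    (ho : IsOpen (range i)) : Function.Surjective i := by
  have hcl : IsClopen (range i) := ⟨(isCompact_range hi).isClosed, ho⟩
  have hemb := (hi.isClosedEmbedding hinj)
  have hI : Function.Injective hi.connectedComponentsMap := by
    intro x y h
    obtain ⟨e, rfl⟩ := ConnectedComponents.surjective_coe x
    obtain ⟨e', rfl⟩ := ConnectedComponents.surjective_coe y
    have h : (ConnectedComponents.mk (i e)) = ConnectedComponents.mk (i e') := h
    rw [ConnectedComponents.coe_eq_coe'] at h
    have hsub : connectedComponent (i e') ⊆ range i :=
      hcl.connectedComponent_subset ⟨e', rfl⟩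
    have hpre : IsPreconnected (i ⁻¹' connectedComponent (i e')) := by
      rw [← hemb.isInducing.isPreconnected_image, image_preimage_eq_of_subset hsub]
      exact isPreconnected_connectedComponent
    have := hpre.subset_connectedComponent (x := e') (mem_connectedComponent) h
    exact ConnectedComponents.coe_eq_coe'.2 this
  have hS := Finite.surjective_of_injective hI
  intro y
  obtain ⟨x, hx⟩ := hS (ConnectedComponents.mk y)
  obtain ⟨e, rfl⟩ := ConnectedComponents.surjective_coe x
  have hx : ConnectedComponents.mk (i e) = ConnectedComponents.mk y := hx
  rw [eq_comm, ConnectedComponents.coe_eq_coe'] at hx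
  exact hcl.connectedComponent_subset ⟨e, rfl⟩ hx

lemma sort_ends {E M : Type*} [TopologicalSpace E] [CompactSpace E] [T2Space E]
    [LocallyConnectedSpace E] [TopologicalSpace M] [T2Space M]
    (g : E × ↥(Icc (0 : ℝ) 1) → M) (hg : Continuous g) (hgi : Function.Injective g)
    (a b : E → M) (ha : Continuous a) (hb : Continuous b) (hai : Function.Injective a)
    (hends : ∀ p : E × ↥(Icc (0 : ℝ) 1), (g p ∈ range a ∨ g p ∈ range b) ↔
      ((p.2 : ℝ) = 0 ∨ (p.2 : ℝ) = 1))
    (hsub : range a ∪ range b ⊆ range g)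
    (hdis : Disjoint (range a) (range b))
    (hbad : ¬ ∃ x, g (x, 0) ∈ range a ∧ g (x, 1) ∈ range a) :
    ∃ β : E × ℝ → M, Continuous β ∧ InjOn β (univ ×ˢ Icc 0 1) ∧
      β '' (univ ×ˢ Icc 0 1) = range g ∧ range (fun e => β (e, 0)) = range a ∧
      range (fun e => β (e, 1)) = range b := by
  classical
  have hra : IsClosed (range a) := (isCompact_range ha).isClosed
  have hrb : IsClosed (range b) := (isCompact_range hb).isClosed
  have hnot : ∀ p : E × ↥(Icc (0 : ℝ) 1), ((p.2 : ℝ) = 0 ∨ (p.2 : ℝ) = 1) →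
      (g p ∉ range a ↔ g p ∈ range b) := by
    intro p hp
    constructor
    · intro h; exact ((hends p).2 hp).resolve_left h
    · intro h h'; exact disjoint_left.1 hdis h' h
  let B : ↥(Icc (0 : ℝ) 1) → Set E := fun u => {x | g (x, u) ∈ range a}
  have hB : ∀ u : ↥(Icc (0 : ℝ) 1), ((u : ℝ) = 0 ∨ (u : ℝ) = 1) → IsClopen (B u) := by
    intro u hu
    have hc : Continuous (fun x => g (x, u)) := hg.comp (by fun_prop)
    refine ⟨hra.preimage hc, ?_⟩
    have : B u = (((fun x => g (x, u)) ⁻¹' range b))ᶜ := by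
      ext x
      have := hnot (x, u) hu
      simp only [B, mem_compl_iff, mem_preimage]
      show g (x, u) ∈ range a ↔ _
      rw [← this, not_not]
    rw [this]
    exact (hrb.preimage hc).isOpen_compl
  have hB0 := hB 0 (by simp)
  have hB1 := hB 1 (by simp)
  let gh := (hg.isClosedEmbedding hgi).isEmbedding.toHomeomorph
  let ai : E → E × ↥(Icc (0 : ℝ) 1) := fun e => gh.symm ⟨a e, hsub (Or.inl ⟨e, rfl⟩)⟩
  have hgai : ∀ e, g (ai e) = a e := by
    intro e
    have : gh (ai e) = ⟨a e, hsub (Or.inl ⟨e, rfl⟩)⟩ := by simp [ai]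
    exact congrArg Subtype.val this
  have haic : Continuous ai := gh.symm.continuous.comp (by fun_prop)
  have hai2 : ∀ e, ai e = ((ai e).1, 0) ∨ ai e = ((ai e).1, 1) := by
    intro e
    rcases (hends (ai e)).1 (Or.inl ⟨e, (hgai e).symm⟩) with h | h
    · left; ext1
      · rfl
      · exact Subtype.ext h
    · right; ext1
      · rfl
      · exact Subtype.ext h
  have hsurj : Function.Surjective (fun e => (ai e).1) := by
    apply inj_surj
    · exact continuous_fst.comp haic
    · intro e e' h
      simp only at h
      have key : ai e = ai e' → e = e' := fun h => hai (by rw [← hgai, ← hgai, h])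
      rcases hai2 e with h1 | h1 <;> rcases hai2 e' with h2 | h2
      · exact key (by rw [h1, h2, h])
      · exact absurd ⟨(ai e).1, by rw [← h1, hgai]; exact ⟨e, rfl⟩,
          by rw [h, ← h2, hgai]; exact ⟨e', rfl⟩⟩ hbad
      · exact absurd ⟨(ai e).1, by rw [h, ← h2, hgai]; exact ⟨e', rfl⟩,
          by rw [← h1, hgai]; exact ⟨e, rfl⟩⟩ hbad
      · exact key (by rw [h1, h2, h])
    · have : range (fun e => (ai e).1) = B 0 ∪ B 1 := by
        ext x
        constructor
        · rintro ⟨e, rfl⟩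
          rcases hai2 e with h | h
          · left; show g ((ai e).1, 0) ∈ range a; rw [← h, hgai]; exact ⟨e, rfl⟩
          · right; show g ((ai e).1, 1) ∈ range a; rw [← h, hgai]; exact ⟨e, rfl⟩
        · rintro (⟨e, he⟩ | ⟨e, he⟩)
          · refine ⟨e, ?_⟩
            rw [← hgai] at he
            simp [hgi he]
          · refine ⟨e, ?_⟩
            rw [← hgai] at he
            simp [hgi he]
      rw [this]; exact hB0.2.union hB1.2
  have hcov : ∀ x, x ∉ B 0 → x ∈ B 1 := by
    intro x hx
    obtain ⟨e, rfl⟩ := hsurj x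
    rcases hai2 e with h | h
    · exfalso; apply hx; show g ((ai e).1, 0) ∈ range a; rw [← h, hgai]; exact ⟨e, rfl⟩
    · show g ((ai e).1, 1) ∈ range a; rw [← h, hgai]; exact ⟨e, rfl⟩
  have hexc : ∀ x, x ∈ B 0 → x ∉ B 1 := fun x h h' => hbad ⟨x, h, h'⟩
  let χ : E → ℝ := fun x => if x ∈ B 0 then 0 else 1
  have hχ : Continuous χ := by
    apply continuous_const.if _ continuous_const
    intro x hx
    have := hB0.frontier_eq
    rw [show frontier {x | x ∈ B 0} = frontier (B 0) from rfl, this] at hx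
    exact absurd hx (notMem_empty _)
  let w : E → ℝ → ℝ := fun x u => u + χ x * (1 - 2 * u)
  have hw0 : ∀ x u, x ∈ B 0 → w x u = u := by intro x u h; simp [w, χ, h]
  have hw1 : ∀ x u, x ∉ B 0 → w x u = 1 - u := by intro x u h; simp [w, χ, h]; ring
  have hww : ∀ x u, w x (w x u) = u := by
    intro x u
    by_cases h : x ∈ B 0
    · rw [hw0 _ _ h, hw0 _ _ h]
    · rw [hw1 _ _ h, hw1 _ _ h]; ring
  have hwI : ∀ x, ∀ u ∈ Icc (0 : ℝ) 1, w x u ∈ Icc (0 : ℝ) 1 := by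
    intro x u hu
    by_cases h : x ∈ B 0
    · rwa [hw0 _ _ h]
    · rw [hw1 _ _ h]; exact ⟨by linarith [hu.2], by linarith [hu.1]⟩
  let β : E × ℝ → M := fun p => g (p.1, projIcc 0 1 zero_le_one (w p.1 p.2))
  have hβ : ∀ x u (hu : u ∈ Icc (0 : ℝ) 1), β (x, u) = g (x, ⟨w x u, hwI x u hu⟩) := by
    intro x u hu
    simp only [β]
    rw [projIcc_of_mem zero_le_one (hwI x u hu)]
  have m0 : (0 : ℝ) ∈ Icc (0 : ℝ) 1 := ⟨le_rfl, zero_le_one⟩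
  have m1 : (1 : ℝ) ∈ Icc (0 : ℝ) 1 := ⟨zero_le_one, le_rfl⟩
  have hβ0 : ∀ x, x ∈ B 0 → β (x, 0) = g (x, 0) ∧ β (x, 1) = g (x, 1) := by
    intro x hx
    rw [hβ x 0 m0, hβ x 1 m1]
    simp only [hw0 x _ hx]; exact ⟨rfl, rfl⟩
  have hβ1 : ∀ x, x ∉ B 0 → β (x, 0) = g (x, 1) ∧ β (x, 1) = g (x, 0) := by
    intro x hx
    rw [hβ x 0 m0, hβ x 1 m1]
    simp only [hw1 x _ hx, sub_zero, sub_self]; exact ⟨rfl, rfl⟩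
  refine ⟨β, ?_, ?_, ?_, ?_, ?_⟩
  · apply hg.comp
    apply Continuous.prodMk continuous_fst
    apply continuous_projIcc.comp
    simp only [w]
    fun_prop
  · rintro ⟨x, u⟩ ⟨_, hu⟩ ⟨x', u'⟩ ⟨_, hu'⟩ h
    simp only at hu hu'
    rw [hβ _ _ hu, hβ _ _ hu'] at h
    have h := hgi h
    simp only [Prod.mk.injEq, Subtype.mk.injEq] at h
    obtain ⟨rfl, h⟩ := h
    have := hww x u
    rw [h, hww] at this
    rw [this]
  · ext y
    constructor
    · rintro ⟨⟨x, u⟩, ⟨_, hu⟩, rfl⟩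
      exact ⟨_, rfl⟩
    · rintro ⟨⟨x, u, hu⟩, rfl⟩
      refine ⟨(x, w x u), ⟨mem_univ _, hwI x u hu⟩, ?_⟩
      rw [hβ _ _ (hwI x u hu)]
      simp only [hww]
  · apply Subset.antisymm
    · rintro _ ⟨x, rfl⟩
      by_cases h : x ∈ B 0
      · simp only [(hβ0 x h).1]; exact h
      · simp only [(hβ1 x h).1]; exact hcov x h
    · rintro y hy
      obtain ⟨⟨x, u⟩, rfl⟩ := hsub (Or.inl hy)
      rcases (hends (x, u)).1 (Or.inl hy) with h | h
      · obtain rfl : u = 0 := Subtype.ext h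
        exact ⟨x, (hβ0 x hy).1⟩
      · obtain rfl : u = 1 := Subtype.ext h
        exact ⟨x, (hβ1 x (fun h => hexc x h hy)).1⟩
  · apply Subset.antisymm
    · rintro _ ⟨x, rfl⟩
      by_cases h : x ∈ B 0
      · simp only [(hβ0 x h).2]
        exact (hnot (x, 1) (by simp)).1 (hexc x h)
      · simp only [(hβ1 x h).2]
        exact (hnot (x, 0) (by simp)).1 h
    · rintro y hy
      obtain ⟨⟨x, u⟩, rfl⟩ := hsub (Or.inr hy)
      have hb' := (hends (x, u)).1 (Or.inr hy)
      have hna := (hnot (x, u) hb').2 hy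
      rcases hb' with h | h
      · obtain rfl : u = 0 := Subtype.ext h
        exact ⟨x, (hβ1 x hna).2⟩
      · obtain rfl : u = 1 := Subtype.ext h
        exact ⟨x, (hβ0 x (by by_contra h; exact hna (hcov x h))).2⟩

end PDsec


section PEsec
variable {M : Type*} [TopologicalSpace M] [T2Space M] {E : Type*} [TopologicalSpace E]
  [CompactSpace E] [T2Space E]

namespace IsColl
variable {c : E × ℝ → M} {N K : Set M} {T : ℝ} {n : ℕ}

lemma shellA (hc : IsColl c N K T) (hn : 1 ≤ n) (hM : LocallyEuclidean n M) (hP : PP n)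
    (hE : LocEuc1 n E) (hrig : ConcentricRigidity n N)
    (hbdN : subsetBoundary n N = range (fun e => c (e, 0))) {t : ℝ} (ht : T < t)
    (p : M ≃ₜ M) (h1 : p '' Nt c K t ⊆ No c K t) (h2 : K ⊆ p '' No c K t) :
    ∃ β : E × ℝ → M, Continuous β ∧ InjOn β (univ ×ˢ Icc 0 1) ∧
      β '' (univ ×ˢ Icc 0 1) = N \ p '' No c K t ∧
      range (fun e => β (e, 0)) = range (fun e => c (e, 0)) ∧
      range (fun e => β (e, 1)) = p '' range (fun e => c (e, t)) := by
  have h0 : 0 < t := hc.T0.trans_lt ht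
  haveI := locConn hE
  have hcE : ∀ s : ℝ, Continuous (fun e => c (e, s)) := fun s => hc.cont.comp (by fun_prop)
  have hNo : IsOpen (No c K t) := hc.No_open ht.le
  have hpNo : IsOpen (p '' No c K t) := p.isOpenMap _ hNo
  have hint : interior (p '' Nt c K t) = p '' No c K t := by
    rw [← p.image_interior, hc.interior_Nt ht]
  have hNoint : No c K t ⊆ interior N :=
    hNo.subset_interior_iff.2 (No_sub_Nt.trans (hc.Nt_sub h0.le))
  have hb1 : subsetBoundary n (p '' Nt c K t) = p '' range (fun e => c (e, t)) := by
    rw [subsetBoundary_image, hc.Nt_bdry hM hP hE ht]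
  have hM1c : IsCompact (p '' Nt c K t) := (hc.Nt_compact h0.le).image p.continuous
  -- the embeddings
  have hbc : Continuous (fun e => p (c (e, t))) := p.continuous.comp (hcE t)
  have hbi : Function.Injective (fun e => p (c (e, t))) := fun e e' h =>
    (hc.eq_of h0.le h0.le (p.injective h)).1
  have hbr : range (fun e => p (c (e, t))) = p '' range (fun e => c (e, t)) := by
    rw [← range_comp]; rfl
  have hac : Continuous (fun e => c (e, 0)) := hcE 0
  have hai : Function.Injective (fun e => c (e, 0)) := fun e e' h =>
    (hc.eq_of le_rfl le_rfl h).1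
  let eS : E ≃ₜ ↥(p '' range (fun e => c (e, t))) :=
    (hbc.isClosedEmbedding hbi).isEmbedding.toHomeomorph.trans (Homeomorph.setCongr hbr)
  have heS : ∀ e, (eS e : M) = p (c (e, t)) := fun e => rfl
  let eN : E ≃ₜ ↥(subsetBoundary n N) :=
    (hac.isClosedEmbedding hai).isEmbedding.toHomeomorph.trans (Homeomorph.setCongr hbdN.symm)
  obtain ⟨q0, hq0⟩ := hc.Nt_small hpNo h2
  obtain ⟨q, hq1, hq2⟩ : ∃ q, q0 ≤ q ∧ t < q := ⟨max q0 (t + 1), le_max_left _ _,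
    lt_max_of_lt_right (by linarith)⟩
  have hqs : Nt c K q ⊆ p '' No c K t := hq0 q hq1 (h0.trans hq2).le
  have hbic : Bicollared (p '' range (fun e => c (e, t))) := by
    haveI : CompactSpace ↥(p '' range (fun e => c (e, t))) := eS.compactSpace
    refine ⟨fun z => p (c (eS.symm z.1, t + (t / 2) * z.2)), ?_, ?_⟩
    · refine (Continuous.isClosedEmbedding ?_ ?_).isEmbedding
      · exact p.continuous.comp (hc.cont.comp (by fun_prop))
      · rintro ⟨x, u, hu⟩ ⟨x', u', hu'⟩ h
        have := hc.eq_of (by simp only; nlinarith [hu.1]) (by simp only; nlinarith [hu'.1]) (p.injective h)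
        have h1 := eS.symm.injective this.1
        have h2 : u = u' := mul_left_cancel₀ (half_pos h0).ne' (add_left_cancel this.2)
        simp only at h1
        subst h1 h2; rfl
    · intro x
      have := heS (eS.symm x)
      simp only [mul_zero, add_zero]
      rw [← this]; simp
  have hNt0 : N = Nt c K 0 := by
    rw [Nt, hc.im, union_sdiff_cancel hc.KN']
  have hconc : Concentric n N (Nt c K q) := by
    obtain ⟨φ⟩ := hc.cyl le_rfl (h0.trans hq2)
    refine ⟨(Homeomorph.setCongr ?_).trans (φ.trans (eN.prodCongr (Homeomorph.refl _)))⟩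
    rw [hc.interior_Nt (ht.trans hq2)]
    conv_lhs => rw [hNt0]
    exact hc.diff_eq le_rfl (h0.trans hq2)
  obtain ⟨-, ⟨α0⟩⟩ := hrig (Nt c K q) (p '' Nt c K t) (hc.Nt_mfld hn hM hE (ht.trans hq2))
    (mfld_image p (hc.Nt_mfld hn hM hE ht)) (by rw [hint]; exact hqs) (h1.trans hNoint)
    (by rw [hb1]; exact hbic) (by rw [hb1]; exact ⟨eS.symm.trans eN⟩) hconc
  rw [hint] at α0
  set W : Set M := N \ p '' No c K t with hWdef
  let α : ↥W ≃ₜ E × ↥(Icc (0 : ℝ) 1) := α0.trans (eN.symm.prodCongr (Homeomorph.refl _))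
  have hra : ∀ x ∈ range (fun e => c (e, 0)), x ∉ p '' Nt c K t := by
    rintro _ ⟨e, rfl⟩ h
    exact absurd ((hc.mem_No le_rfl h0.le).1 (h1 h)) (not_lt.2 h0.le)
  have hrb : ∀ x ∈ range (fun e => p (c (e, t))), x ∈ p '' Nt c K t := by
    rintro _ ⟨e, rfl⟩
    exact mem_image_of_mem _ ((hc.mem_Nt h0.le h0.le).2 le_rfl)
  have hrbW : ∀ x ∈ range (fun e => p (c (e, t))), x ∈ W := by
    rintro _ ⟨e, rfl⟩
    refine ⟨hc.Nt_sub h0.le (No_sub_Nt (h1 (hrb _ ⟨e, rfl⟩))), ?_⟩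
    rw [p.injective.mem_set_image, hc.mem_No h0.le h0.le]; exact lt_irrefl _
  have hWM1 : ∀ x ∈ W, x ∈ p '' Nt c K t → x ∈ range (fun e => p (c (e, t))) := by
    rintro _ hw ⟨y, hy, rfl⟩
    have hy2 : y ∉ No c K t := fun h => hw.2 (mem_image_of_mem _ h)
    obtain ⟨e, s, hs, rfl⟩ := hc.ex_of (hc.Nt_sub h0.le hy) (fun hk => hy2 (Or.inl hk))
    rw [hc.mem_Nt hs h0.le] at hy
    rw [hc.mem_No hs h0.le, not_lt] at hy2
    obtain rfl := le_antisymm hy hy2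
    exact ⟨e, rfl⟩
  have hWb : ∀ x (hx : x ∈ W), ¬ EucAt n (⟨x, hx⟩ : W) ↔
      (x ∈ range (fun e => c (e, 0)) ∨ x ∈ range (fun e => p (c (e, t)))) := by
    intro x hx
    by_cases hx1 : x ∈ p '' Nt c K t
    · refine iff_of_true ?_ (Or.inr (hWM1 x hx hx1))
      obtain ⟨e, rfl⟩ := hWM1 x hx hx1
      have e1 := locSame_sub p.toOpenPartialHomeomorph (S := p ⁻¹' W) (S' := W)
        (by intro y _; rfl) (a := c (e, t)) (by simp) hx hx
      have e2 := hc.locSame (S := p ⁻¹' W) (p := (e, t)) ht hx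
      have e3 := locSame_lower (S := c ⁻¹' (p ⁻¹' W)) (e := e) (t := t)
        (O := {q | 0 < q.2} ∩ (fun q => p (c q)) ⁻¹' interior N)
        ((isOpen_lt (by fun_prop) (by fun_prop)).inter
          (isOpen_interior.preimage (p.continuous.comp hc.cont)))
        ⟨h0, hNoint (h1 hx1)⟩ (by
          rintro ⟨e', s⟩ ⟨hs, hN'⟩
          have hs : 0 < s := hs
          have hN' := interior_subset hN'
          show (p (c (e', s)) ∈ N ∧ p (c (e', s)) ∉ p '' No c K t) ↔ s ≤ t
          rw [p.injective.mem_set_image, hc.mem_No hs.le h0.le, not_lt]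
          exact and_iff_right hN') hx
      intro hcon
      exact not_eucAt_zero hP hE e ((e1.symm.trans (e2.trans e3)).eucAt.1 hcon)
    · have hxb : x ∉ range (fun e => p (c (e, t))) := fun h => hx1 (hrb x h)
      rw [or_iff_left hxb, ← hbdN, mem_subsetBoundary]
      have := (locSame_of_inter (S := W) (S' := N) hM1c.isClosed.isOpen_compl hx1 (by
        intro y hy
        exact ⟨fun h => h.1, fun h => ⟨h, fun h' => hy (image_mono No_sub_Nt h')⟩⟩) hx hx.1).eucAt
        (n := n)
      rw [this]
      exact ⟨fun h => ⟨hx.1, h⟩, fun ⟨_, h⟩ => h⟩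
  let g : E × ↥(Icc (0 : ℝ) 1) → M := fun z => α.symm z
  have hgemb : IsEmbedding g := IsEmbedding.subtypeVal.comp α.symm.isEmbedding
  have hgr : range g = W := by
    have : g = Subtype.val ∘ α.symm := rfl
    rw [this, range_comp, α.symm.surjective.range_eq, image_univ, Subtype.range_val]
  have hends : ∀ z : E × ↥(Icc (0 : ℝ) 1),
      (g z ∈ range (fun e => c (e, 0)) ∨ g z ∈ range (fun e => p (c (e, t)))) ↔
      ((z.2 : ℝ) = 0 ∨ (z.2 : ℝ) = 1) := by
    intro z
    rw [← eucAt_cyl hn hP hE, ← hWb (g z) (α.symm z).2, (α.symm.locSame z).eucAt]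
  have hdis : Disjoint (range (fun e => c (e, 0))) (range (fun e => p (c (e, t)))) :=
    disjoint_left.2 fun x h h' => hra x h (hrb x h')
  have hraW : ∀ x ∈ range (fun e => c (e, 0)), x ∈ W := by
    intro x hx
    refine ⟨?_, fun h => hra x hx (image_mono No_sub_Nt h)⟩
    obtain ⟨e, rfl⟩ := hx
    exact (hc.notK le_rfl).1
  rw [← hbr, ← hgr]
  refine sort_ends g hgemb.continuous hgemb.injective _ _ hac hbc hai hends ?_ hdis ?_
  · rw [hgr]
    rintro x (h | h)
    · exact hraW x h
    · exact hrbW x h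
  · rintro ⟨x, hx0, hx1⟩
    have hcl : ∀ u : ↥(Icc (0 : ℝ) 1), ((u : ℝ) = 0 ∨ (u : ℝ) = 1) →
        IsClopen {x | g (x, u) ∈ range (fun e => c (e, 0))} := by
      intro u hu
      have hcg : Continuous (fun x => g (x, u)) := hgemb.continuous.comp (by fun_prop)
      refine ⟨(isCompact_range hac).isClosed.preimage hcg, ?_⟩
      have : {x | g (x, u) ∈ range (fun e => c (e, 0))} =
          ((fun x => g (x, u)) ⁻¹' range (fun e => p (c (e, t))))ᶜ := by
        ext x
        have := (hends (x, u)).2 hu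
        constructor
        · exact fun h h' => disjoint_left.1 hdis h h'
        · exact fun h => this.resolve_right h
      rw [this]
      exact ((isCompact_range hbc).isClosed.preimage hcg).isOpen_compl
    let B : Set E := {x | g (x, 0) ∈ range (fun e => c (e, 0))} ∩
      {x | g (x, 1) ∈ range (fun e => c (e, 0))}
    have hB : IsClopen B := (hcl 0 (by simp)).inter (hcl 1 (by simp))
    let Y : Set M := g '' (B ×ˢ univ)
    have hYc : IsClosed Y :=
      ((hB.1.isCompact.prod isCompact_univ).image hgemb.continuous).isClosed
    obtain ⟨O, hO, hOB⟩ := hgemb.isOpen_iff.1 (hB.2.prod (isOpen_univ (X := ↥(Icc (0 : ℝ) 1))))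
    have hYO : Y = O ∩ W := by
      rw [← hgr, ← image_preimage_eq_inter_range, hOB]
    have hYM : ∀ y ∈ Y, y ∉ p '' Nt c K t := by
      rintro _ ⟨⟨z, u⟩, ⟨hz, _⟩, rfl⟩ hcon
      have hb' := hWM1 _ (by rw [← hgr]; exact ⟨_, rfl⟩) hcon
      rcases (hends (z, u)).1 (Or.inr hb') with h | h
      · obtain rfl : u = 0 := Subtype.ext h
        exact disjoint_left.1 hdis hz.1 hb'
      · obtain rfl : u = 1 := Subtype.ext h
        exact disjoint_left.1 hdis hz.2 hb'
    obtain ⟨e, he⟩ := hx0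
    have hφ : Continuous (fun s : ℝ => c (e, |s|)) := hc.cont.comp (by fun_prop)
    have hclop : IsClopen ((fun s : ℝ => c (e, |s|)) ⁻¹' Y) := by
      refine ⟨hYc.preimage hφ, ?_⟩
      have : (fun s : ℝ => c (e, |s|)) ⁻¹' Y =
          (fun s : ℝ => c (e, |s|)) ⁻¹' (O ∩ (p '' Nt c K t)ᶜ) := by
        ext s
        constructor
        · intro hs
          exact ⟨(hYO ▸ hs : c (e, |s|) ∈ O ∩ W).1, hYM _ hs⟩
        · rintro ⟨hs1, hs2⟩
          show c (e, |s|) ∈ Y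
          rw [hYO]
          exact ⟨hs1, (hc.notK (abs_nonneg s)).1, fun h => hs2 (image_mono No_sub_Nt h)⟩
      rw [this]
      exact (hO.inter hM1c.isClosed.isOpen_compl).preimage hφ
    have huniv := hclop.eq_univ ⟨0, by
      show c (e, |0|) ∈ Y
      rw [abs_zero]
      refine ⟨(x, 0), ⟨⟨⟨e, he⟩, hx1⟩, mem_univ _⟩, he.symm⟩⟩
    have hqY : c (e, |q|) ∈ Y := by
      have : q ∈ (fun s : ℝ => c (e, |s|)) ⁻¹' Y := by rw [huniv]; trivial
      exact this
    rw [abs_of_pos (h0.trans hq2)] at hqY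
    exact hYM _ hqY (image_mono No_sub_Nt (hqs ((hc.mem_Nt (h0.trans hq2).le (h0.trans hq2).le).2 le_rfl)))

end IsColl
end PEsec


section PFsec
variable {M : Type*} [TopologicalSpace M] [T2Space M] {E : Type*} [TopologicalSpace E]
  [CompactSpace E]

namespace IsColl
variable {c : E × ℝ → M} {N K : Set M} {T : ℝ} {n : ℕ}

lemma push (hc : IsColl c N K T) {t t' : ℝ} (ht : 0 < t) (htt : t < t') :
    ∃ Φ : M → M, ContinuousOn Φ N ∧ InjOn Φ N ∧ Φ '' N = Nt c K t ∧
      (∀ x ∈ Nt c K t', Φ x = x) ∧ ∀ e, Φ (c (e, 0)) = c (e, t) := by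
  classical
  have ht' : 0 < t' := ht.trans htt
  have hε : 0 < t' - t := sub_pos.2 htt
  let φ : ℝ → ℝ := fun s => max s (t + s * ((t' - t) / t'))
  have hk : 0 < (t' - t) / t' := div_pos hε ht'
  have hk1 : t' * ((t' - t) / t') = t' - t := by field_simp
  have hφc : Continuous φ := by simp only [φ]; fun_prop
  have hφm : StrictMono φ := by
    intro a b hab
    have : a * ((t' - t) / t') < b * ((t' - t) / t') := mul_lt_mul_of_pos_right hab hk
    exact max_lt_max hab (by linarith)
  have hφid : ∀ s, t' ≤ s → φ s = s := by
    intro s hs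
    apply max_eq_left
    have h3 : (t' - t) / t' ≤ 1 := by rw [div_le_one ht']; linarith
    nlinarith
  have hφ0 : φ 0 = t := by simp [φ, ht.le]
  have hφt : ∀ s, 0 ≤ s → t ≤ φ s := fun s hs => by
    rw [← hφ0]; exact hφm.monotone hs
  have hφs : ∀ v, t ≤ v → ∃ s, 0 ≤ s ∧ φ s = v := by
    intro v hv
    have h1 : v ∈ Icc (φ 0) (φ (max v t')) := by
      rw [hφid _ (le_max_right _ _), hφ0]
      exact ⟨hv, le_max_left _ _⟩
    obtain ⟨s, hs, hs'⟩ := intermediate_value_Icc (ht'.le.trans (le_max_right _ _))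
      hφc.continuousOn h1
    exact ⟨s, hs.1, hs'⟩
  let Φ : M → M := fun x =>
    if h : ∃ p : E × ℝ, 0 ≤ p.2 ∧ c p = x then c (h.choose.1, φ h.choose.2) else x
  have hΦc : ∀ e s, 0 ≤ s → Φ (c (e, s)) = c (e, φ s) := by
    intro e s hs
    have h : ∃ p : E × ℝ, 0 ≤ p.2 ∧ c p = c (e, s) := ⟨(e, s), hs, rfl⟩
    simp only [Φ]
    rw [dif_pos h]
    obtain ⟨h1, h2⟩ := hc.eq_of (e := h.choose.1) (s := h.choose.2) h.choose_spec.1 hs h.choose_spec.2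
    rw [h1, h2]
  have hΦK : ∀ x ∈ K, Φ x = x := by
    intro x hx
    simp only [Φ]
    rw [dif_neg]
    rintro ⟨⟨e, s⟩, hs, rfl⟩
    exact (hc.notK hs).2 hx
  have hΦid : ∀ x ∈ Nt c K t', Φ x = x := by
    rintro x (hx | ⟨⟨e, s⟩, ⟨_, hs⟩, rfl⟩)
    · exact hΦK x hx
    · have hs : t' ≤ s := hs
      rw [hΦc _ _ (ht'.le.trans hs), hφid _ hs]
  refine ⟨Φ, ?_, ?_, ?_, hΦid, fun e => by rw [hΦc _ _ le_rfl, hφ0]⟩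
  · have hN : N = c '' (univ ×ˢ Icc 0 t') ∪ Nt c K t' := by
      ext x
      constructor
      · intro hx
        by_cases hK : x ∈ K
        · exact Or.inr (Or.inl hK)
        · obtain ⟨e, s, hs, rfl⟩ := hc.ex_of hx hK
          rcases le_total s t' with h | h
          · exact Or.inl (mem_image_of_mem _ ⟨mem_univ _, hs, h⟩)
          · exact Or.inr ((hc.mem_Nt hs ht'.le).2 h)
      · rintro (⟨⟨e, s⟩, ⟨_, hs⟩, rfl⟩ | hx)
        · exact (hc.notK hs.1).1
        · exact hc.Nt_sub ht'.le hx
    have hQc : IsCompact ((univ : Set E) ×ˢ Icc (0 : ℝ) t') := isCompact_univ.prod isCompact_Icc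
    rw [hN]
    refine ContinuousOn.union_of_isClosed ?_ ?_ (hQc.image hc.cont).isClosed
      (hc.Nt_compact ht'.le).isClosed
    · have : CompactSpace ↥((univ : Set E) ×ˢ Icc (0 : ℝ) t') := isCompact_iff_compactSpace.1 hQc
      let g : ↥((univ : Set E) ×ˢ Icc (0 : ℝ) t') → ↥(c '' (univ ×ˢ Icc 0 t')) :=
        fun z => ⟨c z, mem_image_of_mem _ z.2⟩
      have hg : Continuous g := (hc.cont.comp continuous_subtype_val).subtype_mk _
      have hgs : Function.Surjective g := by
        rintro ⟨_, z, hz, rfl⟩; exact ⟨⟨z, hz⟩, rfl⟩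
      have hq := hg.isClosedMap.isQuotientMap hg hgs
      rw [continuousOn_iff_continuous_domRestrict, hq.continuous_iff]
      have : (c '' (univ ×ˢ Icc 0 t')).domRestrict Φ ∘ g = fun z => c (z.1.1, φ z.1.2) := by
        funext z
        exact hΦc _ _ z.2.2.1
      rw [this]
      exact hc.cont.comp (by fun_prop)
    · exact continuousOn_id.congr hΦid
  · intro x hx y hy hxy
    by_cases hxK : x ∈ K <;> by_cases hyK : y ∈ K
    · rwa [hΦK x hxK, hΦK y hyK] at hxy
    · obtain ⟨e, s, hs, rfl⟩ := hc.ex_of hy hyK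
      rw [hΦK x hxK, hΦc _ _ hs] at hxy
      exact absurd (hxy ▸ hxK) (hc.notK (ht.le.trans (hφt s hs))).2
    · obtain ⟨e, s, hs, rfl⟩ := hc.ex_of hx hxK
      rw [hΦK y hyK, hΦc _ _ hs] at hxy
      exact absurd (hxy ▸ hyK) (hc.notK (ht.le.trans (hφt s hs))).2
    · obtain ⟨e, s, hs, rfl⟩ := hc.ex_of hx hxK
      obtain ⟨e', s', hs', rfl⟩ := hc.ex_of hy hyK
      rw [hΦc _ _ hs, hΦc _ _ hs'] at hxy
      obtain ⟨rfl, h⟩ := hc.eq_of (ht.le.trans (hφt s hs)) (ht.le.trans (hφt s' hs')) hxy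
      rw [hφm.injective h]
  · apply Subset.antisymm
    · rintro _ ⟨x, hx, rfl⟩
      by_cases hxK : x ∈ K
      · rw [hΦK x hxK]; exact Or.inl hxK
      · obtain ⟨e, s, hs, rfl⟩ := hc.ex_of hx hxK
        rw [hΦc _ _ hs]
        exact (hc.mem_Nt (ht.le.trans (hφt s hs)) ht.le).2 (hφt s hs)
    · rintro x (hx | ⟨⟨e, v⟩, ⟨_, hv⟩, rfl⟩)
      · exact ⟨x, hc.KN' hx, hΦK x hx⟩
      · obtain ⟨s, hs, hs'⟩ := hφs v hv
        exact ⟨c (e, s), (hc.notK hs).1, by rw [hΦc _ _ hs, hs']⟩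

lemma room (hc : IsColl c N K T) {t : ℝ} (ht : T < t) {S : Set M} (hS : IsCompact S)
    (hSt : S ⊆ No c K t) : ∃ t', t < t' ∧ S ⊆ Nt c K t' := by
  have h0 : 0 < t := hc.T0.trans_lt ht
  obtain ⟨k, hk⟩ := hS.elim_directed_cover (fun k : ℕ => No c K (t + 1 / ((k : ℝ) + 1)))
    (fun k => hc.No_open (by have : (0 : ℝ) < 1 / ((k : ℝ) + 1) := by positivity
                             linarith)) (by
      intro x hx
      rw [mem_iUnion]
      rcases hSt hx with h | ⟨⟨e, s⟩, ⟨_, hs⟩, rfl⟩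
      · exact ⟨0, Or.inl h⟩
      · have hs : t < s := hs
        obtain ⟨k, hk⟩ := exists_nat_one_div_lt (sub_pos.2 hs)
        exact ⟨k, Or.inr (mem_image_of_mem _ ⟨mem_univ _, by
          show t + 1 / ((k : ℝ) + 1) < s
          linarith⟩)⟩) (by
      apply Monotone.directed_le
      intro a b hab
      refine union_subset_union_right _ (image_mono (prod_mono_right (Ioi_subset_Ioi ?_)))
      gcongr)
  exact ⟨_, by have : (0 : ℝ) < 1 / ((k : ℝ) + 1) := by positivity
               linarith, hk.trans No_sub_Nt⟩

lemma shell [T2Space E] (hc : IsColl c N K T) (hn : 1 ≤ n) (hM : LocallyEuclidean n M) (hP : PP n)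
    (hE : LocEuc1 n E) (hrig : ConcentricRigidity n N)
    (hbdN : subsetBoundary n N = range (fun e => c (e, 0))) {t : ℝ} (ht : T < t)
    (p : M ≃ₜ M) (h1 : p '' Nt c K t ⊆ No c K t) (h2 : K ⊆ p '' No c K t) :
    ∃ β : E × ℝ → M, Continuous β ∧ InjOn β (univ ×ˢ Icc 0 1) ∧
      β '' (univ ×ˢ Icc 0 1) = Nt c K t \ p '' No c K t ∧
      range (fun e => β (e, 0)) = range (fun e => c (e, t)) ∧
      range (fun e => β (e, 1)) = p '' range (fun e => c (e, t)) := by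
  have h0 : 0 < t := hc.T0.trans_lt ht
  obtain ⟨β, hβ, hβi, hβr, hβ0, hβ1⟩ := hc.shellA hn hM hP hE hrig hbdN ht p h1 h2
  obtain ⟨t', htt, hS⟩ := hc.room ht ((hc.Nt_compact h0.le).image p.continuous) h1
  obtain ⟨Φ, hΦ, hΦi, hΦr, hΦid, hΦ0⟩ := hc.push h0 htt
  have hPid : ∀ x ∈ p '' Nt c K t, Φ x = x := fun x hx => hΦid x (hS hx)
  have m0 : (0 : ℝ) ∈ Icc (0 : ℝ) 1 := ⟨le_rfl, zero_le_one⟩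
  have m1 : (1 : ℝ) ∈ Icc (0 : ℝ) 1 := ⟨zero_le_one, le_rfl⟩
  let pr : ℝ → ℝ := fun u => projIcc (0 : ℝ) 1 zero_le_one u
  have hpr : ∀ u ∈ Icc (0 : ℝ) 1, pr u = u := fun u hu => by
    simp only [pr]; rw [projIcc_of_mem zero_le_one hu]
  have hprI : ∀ u, pr u ∈ Icc (0 : ℝ) 1 := fun u => (projIcc (0 : ℝ) 1 zero_le_one u).2
  have hβN : ∀ x, ∀ u ∈ Icc (0 : ℝ) 1, β (x, u) ∈ N := by
    intro x u hu
    have : β (x, u) ∈ N \ p '' No c K t := by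
      rw [← hβr]; exact mem_image_of_mem _ ⟨mem_univ _, hu⟩
    exact this.1
  refine ⟨fun z => Φ (β (z.1, pr z.2)), ?_, ?_, ?_, ?_, ?_⟩
  · refine hΦ.comp_continuous (hβ.comp ?_) (fun z => hβN _ _ (hprI _))
    exact continuous_fst.prodMk
      (continuous_subtype_val.comp (continuous_projIcc.comp continuous_snd))
  · rintro ⟨x, u⟩ ⟨_, hu⟩ ⟨x', u'⟩ ⟨_, hu'⟩ h
    simp only at hu hu' h
    rw [hpr u hu, hpr u' hu'] at h
    exact hβi ⟨mem_univ _, hu⟩ ⟨mem_univ _, hu'⟩ (hΦi (hβN _ _ hu) (hβN _ _ hu') h)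
  · have e1 : (fun z : E × ℝ => Φ (β (z.1, pr z.2))) '' (univ ×ˢ Icc 0 1) =
        Φ '' (β '' (univ ×ˢ Icc 0 1)) := by
      rw [← image_comp]
      apply image_congr
      rintro ⟨x, u⟩ ⟨_, hu⟩
      simp only [Function.comp]
      rw [hpr u hu]
    have hPN : p '' No c K t ⊆ p '' Nt c K t := image_mono No_sub_Nt
    have hNN : p '' Nt c K t ⊆ N := hS.trans (hc.Nt_sub (h0.trans htt).le)
    rw [e1, hβr]
    apply Subset.antisymm
    · rintro _ ⟨x, ⟨hx, hx2⟩, rfl⟩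
      refine ⟨hΦr ▸ mem_image_of_mem _ hx, fun hcon => hx2 ?_⟩
      have := hΦi hx (hNN (hPN hcon)) (hPid _ (hPN hcon)).symm
      rwa [this]
    · rintro x ⟨hx, hx2⟩
      rw [← hΦr] at hx
      obtain ⟨y, hy, rfl⟩ := hx
      refine ⟨y, ⟨hy, fun hcon => hx2 ?_⟩, rfl⟩
      rwa [hPid y (hPN hcon)]
  · simp only [hpr 0 m0]
    have : range (fun e => Φ (β (e, 0))) = Φ '' range (fun e => β (e, 0)) := by
      rw [← range_comp]; rfl
    rw [this, hβ0, ← range_comp]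
    congr 1
    funext e
    exact hΦ0 e
  · simp only [hpr 1 m1]
    have : range (fun e => Φ (β (e, 1))) = Φ '' range (fun e => β (e, 1)) := by
      rw [← range_comp]; rfl
    rw [this, hβ1, ← image_id (p '' range (fun e => c (e, t))), ← image_comp]
    apply image_congr
    rintro _ ⟨_, ⟨e, rfl⟩, rfl⟩
    exact hPid _ (mem_image_of_mem _ ((hc.mem_Nt h0.le h0.le).2 le_rfl))

end IsColl
end PFsec


section PGsec
variable {M : Type*} [TopologicalSpace M] [T2Space M] {n : ℕ} {N K : Set M}

lemma bdry_homeo : Nonempty (↥(spaceBoundary n ↥N) ≃ₜ ↥(subsetBoundary n N)) :=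
  ⟨IsEmbedding.subtypeVal.homeomorphImage _⟩

lemma bdry_compact (hN : IsCompactMfldBdry n N) : CompactSpace ↥(subsetBoundary n N) := by
  have : CompactSpace N := isCompact_iff_compactSpace.1 hN.1
  have hcl : IsClosed (spaceBoundary n ↥N) := by
    rw [← isOpen_compl_iff, isOpen_iff_forall_mem_open]
    intro x hx
    have hx : EucAt n x := not_not.1 hx
    obtain ⟨V, hV, hxV, h⟩ := hx
    exact ⟨V, fun y hy hy' => hy' ⟨V, hV, hy, h⟩, hV, hxV⟩
  have : CompactSpace ↥(spaceBoundary n ↥N) := isCompact_iff_compactSpace.1 hcl.isCompact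
  obtain ⟨φ⟩ := bdry_homeo (n := n) (N := N)
  exact φ.compactSpace

lemma bdry_locEuc1 (hn : 1 ≤ n) (hP : PP n) (hN : IsCompactMfldBdry n N) :
    LocEuc1 n ↥(subsetBoundary n N) := by
  obtain ⟨φ⟩ := bdry_homeo (n := n) (N := N)
  intro e
  obtain ⟨y, hy⟩ := locEuc1_boundary hn hP hN.2 (φ.symm e)
  exact ⟨y, (φ.symm.locSame e).trans hy⟩

lemma exists_coll [CompactSpace ↥(subsetBoundary n N)] (hn : 1 ≤ n) (hM : LocallyEuclidean n M)
    (hP : PP n) (hN : IsCompactMfldBdry n N) (hK : IsCompact K) (hs : IsSpine n N K) :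
    ∃ (c : ↥(subsetBoundary n N) × ℝ → M) (T : ℝ), IsColl c N K T ∧
      subsetBoundary n N = range (fun e => c (e, 0)) := by
  have hE := bdry_locEuc1 hn hP hN
  obtain ⟨hKN, ⟨h⟩⟩ := hs
  let c : ↥(subsetBoundary n N) × ℝ → M := fun p => h.symm (p.1, ⟨max p.2 0, mem_Ici.2 (le_max_right _ _)⟩)
  have hcp : ∀ e s (hs : 0 ≤ s), c (e, s) = h.symm (e, ⟨s, hs⟩) := by
    intro e s hs
    simp only [c, max_eq_left hs]
  have hcx : ∀ x (hx : x ∈ N \ K), c ((h ⟨x, hx⟩).1, (h ⟨x, hx⟩).2) = x := by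
    intro x hx
    rw [hcp _ _ (h ⟨x, hx⟩).2.2]
    simp
  have hemb : IsEmbedding (fun p : ↥(subsetBoundary n N) × ↥(Ici (0 : ℝ)) => c (p.1, p.2)) := by
    have : (fun p : ↥(subsetBoundary n N) × ↥(Ici (0 : ℝ)) => c (p.1, p.2)) =
        Subtype.val ∘ h.symm := by
      funext p
      exact hcp _ _ p.2.2
    rw [this]
    exact IsEmbedding.subtypeVal.comp h.symm.isEmbedding
  let L : Set ↥(N \ K) := {z | z.1 ∉ interior N}
  have hL : IsCompact L := by
    rw [IsEmbedding.subtypeVal.isCompact_iff]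
    have : Subtype.val '' L = N \ interior N := by
      ext x
      constructor
      · rintro ⟨z, hz, rfl⟩; exact ⟨z.2.1, hz⟩
      · rintro ⟨h1, h2⟩; exact ⟨⟨x, h1, fun hk => h2 (hKN hk)⟩, h2, rfl⟩
    rw [this]
    exact hN.1.diff isOpen_interior
  obtain ⟨T0, hT0⟩ := (hL.image (f := fun z => ((h z).2 : ℝ)) (by fun_prop)).bddAbove
  refine ⟨c, max T0 0, ⟨?_, ?_, ?_, hemb, hKN, hK, hN.1, le_max_right _ _, ?_⟩, ?_⟩
  · refine continuous_subtype_val.comp (h.symm.continuous.comp ?_)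
    fun_prop
  · rintro ⟨e, s⟩ ⟨_, hs⟩ ⟨e', s'⟩ ⟨_, hs'⟩ heq
    have := hemb.injective (a₁ := (e, ⟨s, hs⟩)) (a₂ := (e', ⟨s', hs'⟩)) heq
    simpa using this
  · apply Subset.antisymm
    · rintro _ ⟨p, _, rfl⟩
      exact (h.symm (p.1, ⟨max p.2 0, mem_Ici.2 (le_max_right _ _)⟩)).2
    · intro x hx
      exact ⟨_, ⟨mem_univ _, (h ⟨x, hx⟩).2.2⟩, hcx x hx⟩
  · rintro x ⟨hx, hx2⟩
    by_contra hcon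
    have hxK : x ∈ N \ K := ⟨hx, fun hk => hcon (hKN hk)⟩
    apply hx2
    refine ⟨((h ⟨x, hxK⟩).1, ((h ⟨x, hxK⟩).2 : ℝ)), ⟨mem_univ _, (h ⟨x, hxK⟩).2.2, ?_⟩, hcx x hxK⟩
    exact le_max_of_le_left (hT0 (mem_image_of_mem _ (show (⟨x, hxK⟩ : ↥(N \ K)) ∈ L from hcon)))
  · ext x
    rw [mem_subsetBoundary]
    have key : ∀ hx : x ∈ N \ K, LocSame (⟨x, hx.1⟩ : N) (h ⟨x, hx⟩) := fun hx =>
      (locSame_of_inter (S := N) (S' := N \ K) hK.isClosed.isOpen_compl hx.2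
        (fun y hy => ⟨fun h => ⟨h, hy⟩, fun h => h.1⟩) hx.1 hx).trans (h.locSame _)
    constructor
    · rintro ⟨hx, hne⟩
      have hxK : x ∈ N \ K := by
        refine ⟨hx, fun hk => hne ?_⟩
        exact (locSame_of_nhds isOpen_interior (hKN hk) interior_subset hx).eucAt.2 (hM x)
      rcases eq_or_lt_of_le (show (0 : ℝ) ≤ (h ⟨x, hxK⟩).2 from (h ⟨x, hxK⟩).2.2) with h0 | h0
      · refine ⟨(h ⟨x, hxK⟩).1, ?_⟩
        have := hcx x hxK
        rwa [← h0] at this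
      · exfalso
        apply hne
        rw [(key hxK).eucAt]
        exact ((LocSame.refl (h ⟨x, hxK⟩).1).prod (locSame_Ici h0 (h ⟨x, hxK⟩).2.2)).eucAt.2
          (eucAt_E hn hE _)
    · rintro ⟨e, rfl⟩
      have h1 : c (e, 0) ∈ N \ K := (h.symm (e, ⟨max 0 0, mem_Ici.2 (le_max_right _ _)⟩)).2
      refine ⟨h1.1, ?_⟩
      have := key h1
      have h2 : h ⟨c (e, 0), h1⟩ = (e, ⟨0, mem_Ici.2 (le_refl _)⟩) := by
        rw [← h.apply_symm_apply (e, ⟨0, mem_Ici.2 (le_refl _)⟩)]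
        congr 1
        exact Subtype.ext (hcp _ _ le_rfl)
      rw [h2] at this
      rw [this.eucAt]
      exact not_eucAt_zero hP hE e

end PGsec


section PHsec

lemma sum_homeo {M : Type*} [TopologicalSpace M] {S P Q O1 O2 : Set M} (h1 : IsOpen O1)
    (h2 : IsOpen O2) (hP : P = S ∩ O1) (hQ : Q = S ∩ O2) (hS : S = P ∪ Q)
    (hd : Disjoint P Q) : Nonempty (↥P ⊕ ↥Q ≃ₜ ↥S) := by
  have hPS : P ⊆ S := by rw [hS]; exact subset_union_left
  have hQS : Q ⊆ S := by rw [hS]; exact subset_union_right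
  let φ : ↥P ⊕ ↥Q → ↥S := Sum.elim (inclusion hPS) (inclusion hQS)
  have hc : Continuous φ := (continuous_inclusion hPS).sumElim (continuous_inclusion hQS)
  have hb : Function.Bijective φ := by
    constructor
    · rintro (x | x) (y | y) h
      · exact congrArg Sum.inl (inclusion_injective hPS h)
      · exact absurd y.2 (disjoint_left.1 hd (by
          have := congrArg Subtype.val h
          simp only [φ, Sum.elim_inl, Sum.elim_inr, coe_inclusion] at this
          rw [← this]; exact x.2))
      · exact absurd x.2 (disjoint_left.1 hd (by
          have := congrArg Subtype.val h
          simp only [φ, Sum.elim_inl, Sum.elim_inr, coe_inclusion] at this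
          rw [this]; exact y.2))
      · exact congrArg Sum.inr (inclusion_injective hQS h)
    · rintro ⟨x, hx⟩
      have hx' := hx
      rw [hS] at hx'
      rcases hx' with h | h
      · exact ⟨Sum.inl ⟨x, h⟩, rfl⟩
      · exact ⟨Sum.inr ⟨x, h⟩, rfl⟩
  have ho : IsOpenMap φ := by
    rw [isOpenMap_sum]
    constructor
    · have : IsOpenEmbedding (inclusion hPS) := ⟨IsEmbedding.inclusion hPS, by
        rw [range_inclusion]
        have : {x : ↥S | (x : M) ∈ P} = Subtype.val ⁻¹' O1 := by
          ext x
          rw [hP]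
          exact ⟨fun h => h.2, fun h => ⟨x.2, h⟩⟩
        rw [this]
        exact h1.preimage continuous_subtype_val⟩
      exact this.isOpenMap
    · have : IsOpenEmbedding (inclusion hQS) := ⟨IsEmbedding.inclusion hQS, by
        rw [range_inclusion]
        have : {x : ↥S | (x : M) ∈ Q} = Subtype.val ⁻¹' O2 := by
          ext x
          rw [hQ]
          exact ⟨fun h => h.2, fun h => ⟨x.2, h⟩⟩
        rw [this]
        exact h2.preimage continuous_subtype_val⟩
      exact this.isOpenMap
  exact ⟨(Equiv.ofBijective φ hb).toHomeomorphOfContinuousOpen hc ho⟩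

variable {M : Type*} [TopologicalSpace M] [T2Space M] {E : Type*} [TopologicalSpace E]
  [CompactSpace E] [T2Space E]

namespace IsColl
variable {c : E × ℝ → M} {N K : Set M} {T : ℝ} {n : ℕ}

lemma edge_eq (hc : IsColl c N K T) {t : ℝ} (ht : 0 ≤ t) :
    range (fun e => c (e, t)) = Nt c K t \ No c K t := by
  ext x
  constructor
  · rintro ⟨e, rfl⟩
    exact ⟨(hc.mem_Nt ht ht).2 le_rfl, fun h => lt_irrefl _ ((hc.mem_No ht ht).1 h)⟩
  · rintro ⟨h1, h2⟩
    obtain ⟨e, s, hs, rfl⟩ := hc.ex_of (hc.Nt_sub ht h1) (fun hk => h2 (Or.inl hk))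
    rw [hc.mem_Nt hs ht] at h1
    rw [hc.mem_No hs ht, not_lt] at h2
    obtain rfl := le_antisymm h1 h2
    exact ⟨e, rfl⟩

lemma one_param (hc : IsColl c N K T) (hn : 1 ≤ n) (hM : LocallyEuclidean n M) (hP : PP n)
    (hE : LocEuc1 n E) (hrig : ConcentricRigidity n N)
    (hbdN : subsetBoundary n N = range (fun e => c (e, 0))) {t s : ℝ} (ht : T < t)
    (hts : t < s) (g : M ≃ₜ M) (hgK : g '' K = K) (k l : ℕ)
    (hk : ∀ m ≥ k, g^[m] '' Nt c K t ⊆ No c K t)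
    (hl : ∀ m ≥ l, g.symm^[m] '' Nt c K s ⊆ No c K s) :
    ∃ A : Set M, (IsCompact A ∧ IsAttractor g A ∧ ∃ C : Set M, IsCompact C ∧
      Nonempty (↥C ≃ₜ E × ↥(Set.Icc (0 : ℝ) 1)) ∧ IsSpine n C A) ∧
      ∀ m, A ⊆ g^[m] '' Nt c K t := by
  have h0 : 0 < t := hc.T0.trans_lt ht
  have hs0 : 0 < s := h0.trans hts
  have hTs : T < s := ht.trans hts
  obtain ⟨r, hr⟩ : ∃ r, r = k + l + 1 := ⟨_, rfl⟩
  obtain ⟨F, hF, hFs⟩ := homeo_iter g r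
  have hFj : ∀ j : ℕ, F^[j] = g^[r * j] := by
    intro j; rw [hF, Function.iterate_mul]
  have hFt : F '' Nt c K t ⊆ No c K t := by rw [hF]; exact hk r (by omega)
  have hFsS : F.symm '' Nt c K s ⊆ No c K s := by rw [hFs]; exact hl r (by omega)
  have hgKm : ∀ m : ℕ, g^[m] '' K = K := by
    intro m
    induction m with
    | zero => simp
    | succ m ih => rw [Function.iterate_succ, image_comp, hgK, ih]
  have hFK : F '' K = K := by rw [hF]; exact hgKm r
  have hFsK : F.symm '' K = K := by
    conv_lhs => rw [← hFK]
    rw [← image_comp]; simp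
  have hKo : ∀ u : ℝ, K ⊆ No c K u := fun u => subset_union_left
  obtain ⟨β, hβ, hβi, hβr, hβ0, hβ1⟩ := hc.shell hn hM hP hE hrig hbdN ht F hFt
    (by rw [← hFK]; exact image_mono (by rw [hFK]; exact hKo t))
  obtain ⟨β', hβ', hβi', hβr', hβ0', hβ1'⟩ := hc.shell hn hM hP hE hrig hbdN hTs F.symm hFsS
    (by rw [← hFsK]; exact image_mono (by rw [hFsK]; exact hKo s))
  rw [hc.edge_eq h0.le] at hβ0 hβ1
  rw [hc.edge_eq hs0.le] at hβ0' hβ1'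
  obtain ⟨G1⟩ := glue F (Nt c K t) (No c K t) (hc.Nt_compact h0.le).isClosed hFt No_sub_Nt β hβ
    hβi hβr hβ0 hβ1
  have hFZ2 : F '' (No c K s)ᶜ ⊆ (Nt c K s)ᶜ := by
    rintro _ ⟨x, hx, rfl⟩ hcon
    have := hFsS (mem_image_of_mem _ hcon)
    rw [F.symm_apply_apply] at this
    exact hx this
  have hFcan : ∀ S : Set M, F '' (F.symm '' S) = S := by
    intro S; rw [← image_comp]; simp
  obtain ⟨G2⟩ := glue F (No c K s)ᶜ (Nt c K s)ᶜ (hc.No_open hTs.le).isClosed_compl hFZ2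
    (compl_subset_compl.2 No_sub_Nt) (fun z => F (β' (z.1, 1 - z.2)))
    (F.continuous.comp (hβ'.comp (by fun_prop)))
    (by
      rintro ⟨x, u⟩ ⟨_, hu⟩ ⟨x', u'⟩ ⟨_, hu'⟩ h
      simp only at hu hu'
      have := hβi' (x₁ := (x, 1 - u)) (x₂ := (x', 1 - u'))
        ⟨mem_univ _, by constructor <;> simp only <;> linarith [hu.1, hu.2]⟩
        ⟨mem_univ _, by constructor <;> simp only <;> linarith [hu'.1, hu'.2]⟩ (F.injective h)
      simpa using this)
    (by
      have e1 : (fun z : E × ℝ => F (β' (z.1, 1 - z.2))) '' (univ ×ˢ Icc 0 1) =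
          F '' (β' '' (univ ×ˢ Icc 0 1)) := by
        ext y
        constructor
        · rintro ⟨⟨x, u⟩, ⟨_, hu⟩, rfl⟩
          simp only at hu
          exact mem_image_of_mem _ (mem_image_of_mem _
            ⟨mem_univ _, by constructor <;> simp only <;> linarith [hu.1, hu.2]⟩)
        · rintro ⟨_, ⟨⟨x, u⟩, ⟨_, hu⟩, rfl⟩, rfl⟩
          simp only at hu
          refine ⟨(x, 1 - u), 
            ⟨mem_univ _, by constructor <;> simp only <;> linarith [hu.1, hu.2]⟩, ?_⟩
          simp
      rw [e1, hβr', image_sdiff F.injective, hFcan, image_compl_eq F.bijective]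
      ext x; simp only [mem_sdiff, mem_compl_iff, not_not]; tauto)
    (by
      have : range (fun e => F (β' (e, 1))) = F '' range (fun e => β' (e, 1)) := by
        rw [← range_comp]; rfl
      simp only [sub_zero]
      rw [this, hβ1', hFcan]
      ext x; simp only [mem_sdiff, mem_compl_iff, not_not]; tauto)
    (by
      have : range (fun e => F (β' (e, 0))) = F '' range (fun e => β' (e, 0)) := by
        rw [← range_comp]; rfl
      simp only [sub_self]
      rw [this, hβ0']
      congr 1
      ext x; simp only [mem_sdiff, mem_compl_iff, not_not]; tauto)
  set A1 : Set M := ⋂ j : ℕ, F^[j] '' Nt c K t with hA1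
  set A2 : Set M := ⋂ j : ℕ, F^[j] '' (No c K s)ᶜ with hA2
  have hclosed : ∀ S : Set M, IsClosed S → ∀ j : ℕ, IsClosed (F^[j] '' S) := by
    intro S hS j
    obtain ⟨G, hG, -⟩ := homeo_iter F j
    rw [← hG]; exact G.isClosedMap _ hS
  have hA1c : IsClosed A1 := isClosed_iInter fun j =>
    hclosed _ (hc.Nt_compact h0.le).isClosed j
  have hA2c : IsClosed A2 := isClosed_iInter fun j =>
    hclosed _ (hc.No_open hTs.le).isClosed_compl j
  have hA1Z : A1 ⊆ Nt c K t := by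
    intro x hx; simpa using mem_iInter.1 hx 0
  have hA2Z : A2 ⊆ (No c K s)ᶜ := by
    intro x hx; simpa using mem_iInter.1 hx 0
  have hst : Nt c K s ⊆ Nt c K t := (Nt_sub_No hts).trans No_sub_Nt
  have hFit : ∀ (j : ℕ), ∀ x ∈ Nt c K t, F^[j] x ∈ Nt c K t := by
    intro j
    induction j with
    | zero => exact fun x hx => hx
    | succ j ih =>
      intro x hx
      exact ih _ (No_sub_Nt (hFt (mem_image_of_mem _ hx)))
  have hFis : ∀ (j : ℕ), ∀ x ∈ Nt c K s, F.symm^[j] x ∈ Nt c K s := by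
    intro j
    induction j with
    | zero => exact fun x hx => hx
    | succ j ih =>
      intro x hx
      exact ih _ (No_sub_Nt (hFsS (mem_image_of_mem _ hx)))
  have hFinv : ∀ (j : ℕ) x, F^[j] (F.symm^[j] x) = x := fun j x =>
    (Function.RightInverse.iterate F.apply_symm_apply j) x
  have hcov : ∀ x, x ∉ A1 → x ∈ A2 := by
    intro x hx
    rw [hA1, mem_iInter] at hx
    push Not at hx
    obtain ⟨j, hj⟩ := hx
    rw [hA2, mem_iInter]
    intro i
    refine ⟨F.symm^[i] x, fun hcon => hj ?_, hFinv i x⟩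
    refine ⟨F^[i] (F.symm^[j] (F.symm^[i] x)), hFit i _ (hst (hFis j _ (No_sub_Nt hcon))), ?_⟩
    rw [← Function.iterate_add_apply, add_comm, Function.iterate_add_apply, hFinv, hFinv]
  have hCeq : Nt c K t \ No c K s = c '' (univ ×ˢ Icc t s) := hc.diff_eq h0.le hts
  set C : Set M := Nt c K t \ No c K s with hC
  have hCc : IsCompact C := (hc.Nt_compact h0.le).diff (hc.No_open hTs.le)
  have hAC : A1 ∩ A2 ⊆ C := fun x hx => ⟨hA1Z hx.1, hA2Z hx.2⟩
  have hAcomp : IsCompact (A1 ∩ A2) := hCc.of_isClosed_subset (hA1c.inter hA2c) hAC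
  have hint : A1 ∩ A2 ⊆ interior C := by
    have ho : IsOpen (No c K t \ Nt c K s) :=
      (hc.No_open ht.le).sdiff (hc.Nt_compact hs0.le).isClosed
    have hsub : No c K t \ Nt c K s ⊆ C := fun x hx =>
      ⟨No_sub_Nt hx.1, fun h => hx.2 (No_sub_Nt h)⟩
    refine Subset.trans ?_ (interior_maximal hsub ho)
    rintro x ⟨hx1, hx2⟩
    have e1 := mem_iInter.1 hx1 1
    have e2 := mem_iInter.1 hx2 1
    rw [Function.iterate_one] at e1 e2
    exact ⟨hFt e1, hFZ2 e2⟩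
  have hFjinj : ∀ j : ℕ, Function.Injective F^[j] := fun j => F.injective.iterate j
  refine ⟨A1 ∩ A2, ⟨hAcomp, ⟨hAcomp, C, subset_interior_iff_mem_nhdsSet.1 hint, ?_⟩, C, hCc, ?_,
    hint, ?_⟩, ?_⟩
  · apply Subset.antisymm
    · rintro x ⟨hx1, hx2⟩
      simp only [omegaSet, mem_iInter]
      intro i hi
      apply subset_closure
      simp only [mem_iUnion]
      refine ⟨r * i, ?_, ?_⟩
      · rw [hr]; nlinarith
      · rw [← hFj]
        obtain ⟨y, hy, rfl⟩ := mem_iInter.1 hx1 i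
        obtain ⟨z, hz, hzy⟩ := mem_iInter.1 hx2 i
        rw [hFjinj i hzy] at hz
        exact mem_image_of_mem _ ⟨hy, hz⟩
    · have key : ∀ Z : Set M, IsClosed Z → C ⊆ Z → (∀ m ≥ r, g^[m] '' Z ⊆ Z) →
          omegaSet g C ⊆ ⋂ j : ℕ, F^[j] '' Z := by
        intro Z hZ hCZ hm x hx
        rw [mem_iInter]
        intro j
        simp only [omegaSet, mem_iInter] at hx
        have hx := hx (r * j + r) (by omega)
        refine closure_minimal ?_ (hclosed Z hZ j) hx
        intro y hy
        simp only [mem_iUnion] at hy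
        obtain ⟨i, hi, z, hz, rfl⟩ := hy
        obtain ⟨m, rfl⟩ : ∃ m, i = r * j + m := ⟨i - r * j, by omega⟩
        rw [Function.iterate_add_apply, ← hFj]
        exact mem_image_of_mem _ (hm m (by omega) (mem_image_of_mem _ (hCZ hz)))
      apply subset_inter
      · exact key _ (hc.Nt_compact h0.le).isClosed (fun x hx => hx.1)
          (fun m hm => (hk m (by omega)).trans No_sub_Nt)
      · refine key _ (hc.No_open hTs.le).isClosed_compl (fun x hx => hx.2) ?_
        rintro m hm _ ⟨x, hx, rfl⟩ hcon
        apply hx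
        have := hl m (by omega) (mem_image_of_mem _ (No_sub_Nt hcon))
        have e : g.symm^[m] (g^[m] x) = x :=
          (Function.LeftInverse.iterate g.symm_apply_apply m) x
        rwa [e] at this
  · rw [hCeq]
    exact hc.cyl h0.le hts
  · obtain ⟨b⟩ := hc.cyl_bdry hM hP hE ht hts
    rw [← hCeq] at b
    have hP1 : Nt c K t \ A1 = (C \ (A1 ∩ A2)) ∩ A1ᶜ := by
      ext x
      constructor
      · rintro ⟨h1, h2⟩
        exact ⟨⟨⟨h1, hA2Z (hcov x h2)⟩, fun h => h2 h.1⟩, h2⟩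
      · rintro ⟨⟨h1, _⟩, h2⟩
        exact ⟨h1.1, h2⟩
    have hP2 : (No c K s)ᶜ \ A2 = (C \ (A1 ∩ A2)) ∩ A2ᶜ := by
      ext x
      constructor
      · rintro ⟨h1, h2⟩
        have : x ∈ A1 := by by_contra h; exact h2 (hcov x h)
        exact ⟨⟨⟨hA1Z this, h1⟩, fun h => h2 h.2⟩, h2⟩
      · rintro ⟨⟨h1, _⟩, h2⟩
        exact ⟨h1.2, h2⟩
    obtain ⟨sh⟩ := sum_homeo (S := C \ (A1 ∩ A2)) hA1c.isOpen_compl hA2c.isOpen_compl hP1 hP2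
      (by
        rw [hP1, hP2]
        ext x
        constructor
        · intro hx
          by_cases h : x ∈ A1
          · exact Or.inr ⟨hx, fun h' => hx.2 ⟨h, h'⟩⟩
          · exact Or.inl ⟨hx, h⟩
        · rintro (h | h) <;> exact h.1)
      (disjoint_left.2 fun x h h' => h'.2 (hcov x h.2))
    exact ⟨sh.symm.trans ((G1.symm.sumCongr G2.symm).trans
      (Homeomorph.sumProdDistrib.symm.trans (b.symm.prodCongr (Homeomorph.refl _))))⟩
  · rintro m x ⟨hx, _⟩
    obtain ⟨y, hy, rfl⟩ := mem_iInter.1 hx (m + k)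
    have : r * (m + k) = m + (r * (m + k) - m) := by
      have : m + k ≤ r * (m + k) := by rw [hr]; nlinarith
      omega
    rw [hFj, this, Function.iterate_add_apply]
    refine mem_image_of_mem _ (No_sub_Nt (hk _ ?_ (mem_image_of_mem _ hy)))
    have : m + k ≤ r * (m + k) := by rw [hr]; nlinarith
    omega

end IsColl
end PHsec


section PIsec

lemma iter_cont {M : Type*} [TopologicalSpace M] {f : unitInterval → M ≃ₜ M}
    (hf : ContinuousFamily f) (m : ℕ) :
    Continuous (fun p : unitInterval × M => (f p.1)^[m] p.2) := by
  induction m with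
  | zero => exact continuous_snd
  | succ m ih =>
    have : (fun p : unitInterval × M => (f p.1)^[m + 1] p.2) =
        (fun p : unitInterval × M => (f p.1)^[m] p.2) ∘ (fun p => (p.1, f p.1 p.2)) := by
      funext p; simp [Function.iterate_succ_apply]
    rw [this]
    exact ih.comp (continuous_fst.prodMk hf.1)

lemma tube {M : Type*} [TopologicalSpace M] {f : unitInterval → M ≃ₜ M}
    (hf : ContinuousFamily f) (m : ℕ) {S O : Set M} (hS : IsCompact S) (hO : IsOpen O)
    (h : (f 0)^[m] '' S ⊆ O) :
    ∃ δ : ℝ, 0 < δ ∧ ∀ lam : unitInterval, (lam : ℝ) < δ → (f lam)^[m] '' S ⊆ O := by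
  obtain ⟨U, V, hU, hV, h0U, hSV, hUV⟩ := generalized_tube_lemma
    (isCompact_singleton (x := (0 : unitInterval))) hS
    (hO.preimage (iter_cont hf m)) (by
      rintro ⟨a, x⟩ ⟨ha, hx⟩
      have ha : a = 0 := ha
      subst ha
      exact h (mem_image_of_mem _ hx))
  obtain ⟨δ, hδ, hb⟩ := Metric.isOpen_iff.1 hU 0 (h0U rfl)
  refine ⟨δ, hδ, ?_⟩
  rintro lam hl _ ⟨x, hx, rfl⟩
  have : lam ∈ U := hb (by
    rw [Metric.mem_ball, Subtype.dist_eq, Real.dist_eq]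
    simpa [abs_of_nonneg lam.2.1] using hl)
  exact hUV (mk_mem_prod this (hSV hx))

lemma tube_fin {M : Type*} [TopologicalSpace M] {f : unitInterval → M ≃ₜ M}
    (hf : ContinuousFamily f) (k : ℕ) {S O : Set M} (hS : IsCompact S) (hO : IsOpen O)
    (h : ∀ m ≥ k, (f 0)^[m] '' S ⊆ O) (b : ℕ) :
    ∃ δ : ℝ, 0 < δ ∧ ∀ lam : unitInterval, (lam : ℝ) < δ → ∀ m ≥ k, m < b →
      (f lam)^[m] '' S ⊆ O := by
  induction b with
  | zero => exact ⟨1, one_pos, fun _ _ m _ hm => absurd hm (Nat.not_lt_zero m)⟩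
  | succ b ih =>
    obtain ⟨δ, hδ, h1⟩ := ih
    by_cases hb : k ≤ b
    · obtain ⟨δ', hδ', h2⟩ := tube hf b hS hO (h b hb)
      refine ⟨min δ δ', lt_min hδ hδ', fun lam hl m hm hmb => ?_⟩
      rcases Nat.lt_succ_iff_lt_or_eq.1 hmb with h3 | rfl
      · exact h1 lam (hl.trans_le (min_le_left _ _)) m hm h3
      · exact h2 lam (hl.trans_le (min_le_right _ _))
    · refine ⟨δ, hδ, fun lam hl m hm hmb => h1 lam hl m hm (by omega)⟩

lemma tube_all {M : Type*} [TopologicalSpace M] {f : unitInterval → M ≃ₜ M}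
    (hf : ContinuousFamily f) (k : ℕ) {S O : Set M} (hS : IsCompact S) (hO : IsOpen O)
    (hOS : O ⊆ S) (h : ∀ m ≥ k, (f 0)^[m] '' S ⊆ O) :
    ∃ δ : ℝ, 0 < δ ∧ ∃ k' : ℕ, ∀ lam : unitInterval, (lam : ℝ) < δ → ∀ m ≥ k',
      (f lam)^[m] '' S ⊆ O := by
  obtain ⟨δ, hδ, h1⟩ := tube_fin hf (k + 1) hS hO (fun m hm => h m (by omega)) (2 * (k + 1))
  refine ⟨δ, hδ, k + 1, fun lam hl m => ?_⟩
  induction m using Nat.strong_induction_on with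
  | _ m ih =>
    intro hm
    by_cases hm2 : m < 2 * (k + 1)
    · exact h1 lam hl m hm hm2
    · rintro _ ⟨x, hx, rfl⟩
      have e : m = (k + 1) + (m - (k + 1)) := by omega
      rw [e, Function.iterate_add_apply]
      refine h1 lam hl (k + 1) le_rfl (by omega) (mem_image_of_mem _ (hOS ?_))
      exact ih (m - (k + 1)) (by omega) (by omega) (mem_image_of_mem _ hx)

end PIsec

theorem main_aux
    {n : ℕ} (hn : 1 ≤ n)
    {M : Type*} [MetricSpace M] [LocallyCompactSpace M]
    (hM : LocallyEuclidean n M)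
    (f : unitInterval → M ≃ₜ M) (hf : ContinuousFamily f)
    (K : Set M) (hKc : IsCompact K) (hKattr : IsAttractor (f 0) K)
    (N : Set M) (hN : IsCompactMfldBdry n N)
    (hspine : IsSpine n N K)
    (hrig : ConcentricRigidity n N)
    (hhopf : ∀ lam : unitInterval, 0 < (lam : ℝ) → IsRepeller (f lam) K) :
    ∃ lam₀ : ℝ, 0 < lam₀ ∧ ∃ Kfam : unitInterval → Set M,
      (∀ lam : unitInterval, 0 < (lam : ℝ) → (lam : ℝ) < lam₀ →
        IsCompact (Kfam lam) ∧ IsAttractor (f lam) (Kfam lam) ∧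
        ∃ C : Set M, IsCompact C ∧
          Nonempty (↥C ≃ₜ ↥(subsetBoundary n N) × ↥(Set.Icc (0 : ℝ) 1)) ∧
          IsSpine n C (Kfam lam)) ∧
      (∀ V : Set M, V ∈ 𝓝ˢ K → ∃ lam₁ : ℝ, 0 < lam₁ ∧
        ∀ lam : unitInterval, 0 < (lam : ℝ) → (lam : ℝ) < lam₁ → Kfam lam ⊆ V) := by
  classical
  by_cases hP : PP n
  · have := bdry_compact hN
    have hE := bdry_locEuc1 hn hP hN
    obtain ⟨c, T, hc, hbdN⟩ := exists_coll hn hM hP hN hKc hspine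
    obtain ⟨hf0K, V', hV', hV'2⟩ := attr_trap hKattr
    obtain ⟨t0, ht0⟩ := hc.Nt_small isOpen_interior (subset_interior_iff_mem_nhdsSet.2 hV')
    obtain ⟨t, ht, htt⟩ : ∃ t, t0 ≤ t ∧ T < t := ⟨max t0 (T + 1), le_max_left _ _,
      lt_max_of_lt_right (by linarith)⟩
    have h0 : 0 < t := hc.T0.trans_lt htt
    have htV : Nt c K t ⊆ V' := (ht0 t ht h0.le).trans interior_subset
    have hNo : IsOpen (No c K t) := hc.No_open htt.le
    obtain ⟨k0, hk0⟩ := hV'2 _ hNo subset_union_left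
    obtain ⟨lam₀, hlam₀, k, hk⟩ := tube_all hf k0 (hc.Nt_compact h0.le) hNo IsColl.No_sub_Nt
      (fun m hm => (image_mono htV).trans (hk0 m hm))
    have hex : ∀ lam : unitInterval, ∃ A : Set M, 0 < (lam : ℝ) → (lam : ℝ) < lam₀ →
        (IsCompact A ∧ IsAttractor (f lam) A ∧ ∃ C : Set M, IsCompact C ∧
        Nonempty (↥C ≃ₜ ↥(subsetBoundary n N) × ↥(Set.Icc (0 : ℝ) 1)) ∧ IsSpine n C A) ∧
        ∀ m, A ⊆ (f lam)^[m] '' Nt c K t := by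
      intro lam
      by_cases h : 0 < (lam : ℝ) ∧ (lam : ℝ) < lam₀
      · obtain ⟨hgK, V'', hV'', hV''2⟩ := attr_trap (hhopf lam h.1)
        obtain ⟨s0, hs0⟩ := hc.Nt_small isOpen_interior
          (subset_interior_iff_mem_nhdsSet.2 hV'')
        obtain ⟨s, hs, hts⟩ : ∃ s, s0 ≤ s ∧ t < s := ⟨max s0 (t + 1), le_max_left _ _,
          lt_max_of_lt_right (by linarith)⟩
        have hsV : Nt c K s ⊆ V'' := (hs0 s hs (h0.trans hts).le).trans interior_subset
        obtain ⟨l, hl⟩ := hV''2 _ (hc.No_open (htt.trans hts).le) subset_union_left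
        have hgK' : f lam '' K = K := by
          conv_lhs => rw [← hgK]
          rw [← image_comp]; simp
        obtain ⟨A, hA⟩ := hc.one_param hn hM hP hE hrig hbdN htt hts (f lam) hgK' k l
          (hk lam h.2) (fun m hm => (image_mono hsV).trans (hl m hm))
        exact ⟨A, fun _ _ => hA⟩
      · exact ⟨∅, fun h1 h2 => absurd ⟨h1, h2⟩ h⟩
    choose Kfam hKfam using hex
    refine ⟨lam₀, hlam₀, Kfam, fun lam h1 h2 => (hKfam lam h1 h2).1, ?_⟩
    intro V hV
    obtain ⟨m, hm⟩ := hV'2 (interior V) isOpen_interior (subset_interior_iff_mem_nhdsSet.2 hV)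
    obtain ⟨δ, hδ, hd⟩ := tube hf m (hc.Nt_compact h0.le) isOpen_interior
      ((image_mono htV).trans (hm m le_rfl))
    refine ⟨min lam₀ δ, lt_min hlam₀ hδ, fun lam h1 h2 => ?_⟩
    exact ((hKfam lam h1 (h2.trans_le (min_le_left _ _))).2 m).trans
      ((hd lam (h2.trans_le (min_le_right _ _))).trans interior_subset)
  · have hemp : subsetBoundary n N = ∅ := by
      rw [eq_empty_iff_forall_notMem]
      intro x hx
      obtain ⟨h, hne⟩ := mem_subsetBoundary.1 hx
      apply hne
      obtain ⟨y, hy⟩ := halfAt_iff.1 (hN.2 ⟨x, h⟩)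
      exact hy.eucAt.2 (eucAt_half_all hn hP y)
    have hie : IsEmpty ↥(subsetBoundary n N) := by rw [hemp]; infer_instance
    have hie2 : IsEmpty ↥(subsetBoundary n (∅ : Set M)) :=
      ⟨fun z => (mem_subsetBoundary.1 z.2).1⟩
    have hie3 : IsEmpty ↥((∅ : Set M) \ ∅) := ⟨fun z => z.2.1⟩
    refine ⟨1, one_pos, fun _ => ∅, ?_, fun V _ => ⟨1, one_pos, fun _ _ _ => empty_subset _⟩⟩
    intro lam _ _
    refine ⟨isCompact_empty, ⟨isCompact_empty, ∅, by simp, ?_⟩, ∅, isCompact_empty,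
      ⟨Homeomorph.empty⟩, empty_subset _, ⟨Homeomorph.empty⟩⟩
    symm
    rw [eq_empty_iff_forall_notMem]
    intro x hx
    simp only [omegaSet, mem_iInter] at hx
    have := hx 1 le_rfl
    simp at this

/-- **Main Theorem** (shape-free formulation). If `K` is a compact attractor of `f₀`,
`K` is a topological spine of a compact `n`-manifold with boundary `N ⊆ M` having the
concentric rigidity property, and `K` undergoes a Hopf bifurcation at `λ = 0`, then for
all sufficiently small `λ > 0` there is a compact attractor `K_λ` of `f_λ` which is a
topological spine of a compact subset of `M` homeomorphic to `∂N × [0,1]`, and the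
family `K_λ` converges to `K` upper semicontinuously as `λ → 0`. -/
theorem main_theorem
    {n : ℕ} (hn : 1 ≤ n)
    {M : Type*} [MetricSpace M] [LocallyCompactSpace M]
    (hM : LocallyEuclidean n M)
    (f : unitInterval → M ≃ₜ M) (hf : ContinuousFamily f)
    (K : Set M) (hKc : IsCompact K) (hKattr : IsAttractor (f 0) K)
    (N : Set M) (hN : IsCompactMfldBdry n N)
    (hspine : IsSpine n N K)
    (hrig : ConcentricRigidity n N)
    (hhopf : ∀ lam : unitInterval, 0 < (lam : ℝ) → IsRepeller (f lam) K) :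
    ∃ lam₀ : ℝ, 0 < lam₀ ∧ ∃ Kfam : unitInterval → Set M,
      (∀ lam : unitInterval, 0 < (lam : ℝ) → (lam : ℝ) < lam₀ →
        IsCompact (Kfam lam) ∧ IsAttractor (f lam) (Kfam lam) ∧
        ∃ C : Set M, IsCompact C ∧
          Nonempty (↥C ≃ₜ ↥(subsetBoundary n N) × ↥(Set.Icc (0 : ℝ) 1)) ∧
          IsSpine n C (Kfam lam)) ∧
      (∀ V : Set M, V ∈ 𝓝ˢ K → ∃ lam₁ : ℝ, 0 < lam₁ ∧
        ∀ lam : unitInterval, 0 < (lam : ℝ) → (lam : ℝ) < lam₁ → Kfam lam ⊆ V) := by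
  exact main_aux hn hM f hf K hKc hKattr N hN hspine hrig hhopf
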